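/- Let m, n ≥ 1 be integers, d = (d₁,…,d_n) ∈ ℕ_{≥2}^n, and let Z be a semialgebraic family with parameters in Ω ⊂ ℝ^m and bounded fibres Z(t) ⊂ (ℝ^n)^n, whose graph is defined by a system of s(Z) polynomial equalities and inequalities involving polynomials of degrees at most p(Z). Then for every t ∈ Ω and every vector of integers H = (H₁,…,H_n) with each H_i ≥ 2: | #({(x^{(1)},…,x^{(n)}) ∈ Z(t) : each x^{(k)} ∈ ∏_{j=1}^n 𝔸_{d_j}(H_j)}) / (∏_{i=1}^n H_i^{d_i+1})^n − ∫_{Z(t)} ∏_{k=1}^n ∏_{i=1}^n (ρ_{d_i}(x_i^{(k)})/(2·ζ(d_i+1))) dx^{(1)}⋯dx^{(n)} | ≤ M₁(Z,d,n)·max_{1≤i≤n} (log H_i)^{l(d_i)}/H_i, where M₁(Z,d,n) = (d₁⋯d_n)^n·(2^{n²}·max_{1≤i≤n} E₁(d_i) + 2^{n(2D+1)+1}·p(Z,d)·(2·p(Z,d)−1)^{n+s(Z,d)−1}), with E₁(d) = 6·d²·2^{d(d−2)}·(d+1)^{d/2}, D = Σ_{i=1}^n (d_i+1), S = s(Z)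 + n·(D + (d₁⋯d_n)^n + 1), P = max{p(Z), max_{1≤j≤n} d_j}, s(Z,d) = 3·S^{2^{D+n}}·P^{(16^{D+n}−1)·⌈log P / log 2⌉} and p(Z,d) = 4^{(4^{D+n}−1)/3}·P^{4^{D+n}}. -/

import Mathlib

open MeasureTheory Set

noncomputable section

def lfun (d : ℕ) : ℕ := if d = 2 then 1 else 0

/-- `α` is a real algebraic number of degree `d` and naive height at most `H`. -/
def IsAlgDegHt (α : ℝ) (d : ℕ) (H : ℝ) : Prop :=
  ∃ P : Polynomial ℤ, Irreducible P ∧ P.natDegree = d ∧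
    (∀ k, |(P.coeff k : ℝ)| ≤ H) ∧ Polynomial.aeval α P = 0

def DeltaDom (d : ℕ) (x : ℝ) : Set (Fin d → ℝ) :=
  {p | (∀ k, |p k| ≤ 1) ∧ |∑ k : Fin d, p k * x ^ ((k : ℕ) + 1)| ≤ 1}

/-- Koleda's density function `ρ_d`. -/
def rho (d : ℕ) (x : ℝ) : ℝ :=
  ∫ p in DeltaDom d x, |∑ k : Fin d, (((k : ℕ) : ℝ) + 1) * p k * x ^ (k : ℕ)|

def zetaR (s : ℕ) : ℝ := ∑' n : ℕ, (1 : ℝ) / ((n : ℝ) + 1) ^ s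

/-- Semialgebraic representation by `s` polynomial relations of degrees at most `p`. -/
def HasSemialgRep {σ : Type} (S : Set (σ → ℝ)) (s p : ℕ) : Prop :=
  ∃ (P : Fin s → MvPolynomial σ ℝ) (c : ℕ) (sel : Fin c → Fin s → Option Bool),
    (∀ i, (P i).totalDegree ≤ p) ∧
    S = ⋃ j, {x | ∀ i, (sel j i).elim True
      (fun e => if e then MvPolynomial.eval x (P i) = 0
                else 0 < MvPolynomial.eval x (P i))}

/-- `E₁(d) = 6 d² 2^{d(d-2)} (d+1)^{d/2}`. -/
def E1 (d : ℕ) : ℝ :=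
  6 * (d : ℝ) ^ 2 * 2 ^ (d * (d - 2)) * ((d : ℝ) + 1) ^ ((d : ℝ) / 2)

/-- `D = Σ_i (d_i + 1)`. -/
def Dconst (n : ℕ) (d : Fin n → ℕ) : ℕ := ∑ i, (d i + 1)

/-- `S = s(Z) + n (D + (d₁⋯d_n)^n + 1)`. -/
def Sconst (n : ℕ) (d : Fin n → ℕ) (s : ℕ) : ℕ :=
  s + n * (Dconst n d + (∏ i, d i) ^ n + 1)

/-- `P = max {p(Z), max_j d_j}`. -/
def Pconst (n : ℕ) (d : Fin n → ℕ) (p : ℕ) : ℕ :=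
  max p (Finset.univ.sup d)

/-- `s(Z,d)`. -/
def sZd (n : ℕ) (d : Fin n → ℕ) (s p : ℕ) : ℕ :=
  3 * Sconst n d s ^ (2 ^ (Dconst n d + n)) *
    Pconst n d p ^
      ((16 ^ (Dconst n d + n) - 1) *
        ⌈Real.log (Pconst n d p) / Real.log 2⌉₊)

/-- `p(Z,d)`. -/
def pZd (n : ℕ) (d : Fin n → ℕ) (s p : ℕ) : ℕ :=
  4 ^ ((4 ^ (Dconst n d + n) - 1) / 3) * Pconst n d p ^ (4 ^ (Dconst n d + n))

/-- The constant `M₁(Z,d,n)`. -/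
def M1const (n : ℕ) (d : Fin n → ℕ) (s p : ℕ) : ℝ :=
  ((∏ i, d i : ℕ) : ℝ) ^ n *
    (2 ^ (n ^ 2) * sSup (Set.range fun i : Fin n => E1 (d i)) +
      2 ^ (n * (2 * Dconst n d + 1) + 1) * (pZd n d s p : ℝ) *
        (2 * (pZd n d s p : ℝ) - 1) ^ (n + sZd n d s p - 1))

section


/-- A function which is a sum of `K` indicators of order-connected sets. -/
def IsIntv (K : ℕ) (f : ℝ → ENNReal) : Prop :=
  ∃ J : Fin K → Set ℝ, (∀ i, (J i).OrdConnected) ∧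
    ∀ a, f a = ∑ i, (J i).indicator (fun _ => (1 : ENNReal)) a

lemma IsIntv.lintegral_le {K : ℕ} {f : ℝ → ENNReal} (hf : IsIntv K f) (μ ν : Measure ℝ)
    (e : ENNReal) (h : ∀ J : Set ℝ, J.OrdConnected → μ J ≤ ν J + e) :
    ∫⁻ a, f a ∂μ ≤ ∫⁻ a, f a ∂ν + K * e := by
  obtain ⟨J, hJ, hf⟩ := hf
  have key : ∀ m : Measure ℝ, ∫⁻ a, f a ∂m = ∑ i, m (J i) := by
    intro m
    simp_rw [hf]
    rw [lintegral_finsetSum]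
    · refine Finset.sum_congr rfl fun i _ => ?_
      rw [lintegral_indicator (hJ i).measurableSet]; simp
    · intro i _
      exact measurable_const.indicator (hJ i).measurableSet
  rw [key, key]
  calc ∑ i, μ (J i) ≤ ∑ i, (ν (J i) + e) := Finset.sum_le_sum fun i _ => h _ (hJ i)
    _ = _ := by rw [Finset.sum_add_distrib]; simp

lemma piFinSucc_symm (N : ℕ) (q : ℝ × (Fin N → ℝ)) :
    (MeasurableEquiv.piFinSuccAbove (fun _ : Fin (N+1) => ℝ) 0).symm q =
      (Fin.cons q.1 q.2 : Fin (N+1) → ℝ) := by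
  change Fin.insertNth (α := fun _ => ℝ) 0 q.1 q.2 = _
  rw [Fin.insertNth_zero']

lemma measurable_cons (N : ℕ) :
    Measurable fun q : ℝ × (Fin N → ℝ) => (Fin.cons q.1 q.2 : Fin (N+1) → ℝ) := by
  have := (MeasurableEquiv.piFinSuccAbove (fun _ : Fin (N+1) => ℝ) 0).symm.measurable
  have h2 : (fun q : ℝ × (Fin N → ℝ) => (Fin.cons q.1 q.2 : Fin (N+1) → ℝ)) =
      (MeasurableEquiv.piFinSuccAbove (fun _ : Fin (N+1) => ℝ) 0).symm := by
    funext q; exact (piFinSucc_symm N q).symm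
  rw [h2]; exact this

lemma hybrid_fin (K : ℕ) (δ : ENNReal) : ∀ (N : ℕ) (μ ν : Fin N → Measure ℝ)
    (_ : ∀ i, IsFiniteMeasure (μ i)) (_ : ∀ i, IsFiniteMeasure (ν i)) (M : Fin N → ENNReal)
    (_ : ∀ i, μ i univ ≤ M i) (_ : ∀ i, ν i univ ≤ M i)
    (_ : ∀ i, ∀ J : Set ℝ, J.OrdConnected → μ i J ≤ ν i J + δ * M i)
    (f : (Fin N → ℝ) → ENNReal) (_ : Measurable f)
    (_ : ∀ x i, IsIntv K (fun a => f (Function.update x i a))),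
    ∫⁻ x, f x ∂(Measure.pi μ) ≤ ∫⁻ x, f x ∂(Measure.pi ν) + K * N * δ * ∏ i, M i := by
  intro N
  induction N with
  | zero =>
    intro μ ν _ _ M _ _ _ f hf _
    have : (Measure.pi μ) = Measure.pi ν := by
      congr 1; exact Subsingleton.elim _ _
    rw [this]; simp
  | succ N ih =>
    intro μ ν hμf hνf M hμ hν hd f hf hs
    have e1 : ∀ m : Fin (N+1) → Measure ℝ, (∀ i, IsFiniteMeasure (m i)) →
        ∫⁻ x, f x ∂(Measure.pi m) =
        ∫⁻ q, f (Fin.cons q.1 q.2) ∂((m 0).prod (Measure.pi fun j => m (Fin.succ j))) := by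
      intro m hm
      have h := (measurePreserving_piFinSuccAbove m 0).symm
      have h2 := h.lintegral_comp hf
      rw [← h2]
      simp only [Fin.succAbove_zero, piFinSucc_symm]
    have hfm : Measurable fun q : ℝ × (Fin N → ℝ) => f (Fin.cons q.1 q.2) := by
      exact hf.comp (measurable_cons N)
    rw [e1 μ hμf, e1 ν hνf, lintegral_prod_symm' _ hfm, lintegral_prod _ hfm.aemeasurable]
    have step1 : ∀ y : Fin N → ℝ, ∫⁻ a, f (Fin.cons a y) ∂(μ 0) ≤
        ∫⁻ a, f (Fin.cons a y) ∂(ν 0) + K * (δ * M 0) := by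
      intro y
      refine IsIntv.lintegral_le ?_ _ _ _ (hd 0)
      have := hs (Fin.cons 0 y) 0
      simpa [Fin.update_cons_zero] using this
    have step2 : ∀ a : ℝ, ∫⁻ y, f (Fin.cons a y) ∂(Measure.pi fun j => μ (Fin.succ j)) ≤
        ∫⁻ y, f (Fin.cons a y) ∂(Measure.pi fun j => ν (Fin.succ j)) +
          K * N * δ * ∏ i : Fin N, M i.succ := by
      intro a
      refine ih _ _ (fun j => hμf _) (fun j => hνf _) (fun j => M j.succ) (fun j => hμ _)
        (fun j => hν _) (fun j => hd _) _ (hfm.comp measurable_prodMk_left) ?_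
      intro y i
      have := hs (Fin.cons a y) i.succ
      simpa [← Fin.cons_update] using this
    calc ∫⁻ y, ∫⁻ a, f (Fin.cons a y) ∂(μ 0) ∂(Measure.pi fun j => μ (Fin.succ j))
        ≤ ∫⁻ y, (∫⁻ a, f (Fin.cons a y) ∂(ν 0) + K * (δ * M 0))
            ∂(Measure.pi fun j => μ (Fin.succ j)) := lintegral_mono step1
      _ = ∫⁻ y, (∫⁻ a, f (Fin.cons a y) ∂(ν 0)) ∂(Measure.pi fun j => μ (Fin.succ j))
          + K * (δ * M 0) * ∏ j : Fin N, μ (Fin.succ j) univ := by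
            rw [lintegral_add_right _ measurable_const, lintegral_const, Measure.pi_univ]
      _ ≤ ∫⁻ y, (∫⁻ a, f (Fin.cons a y) ∂(ν 0)) ∂(Measure.pi fun j => μ (Fin.succ j))
          + K * (δ * M 0) * ∏ j : Fin N, M (Fin.succ j) := by
            gcongr with j; exact hμ _
      _ = ∫⁻ a, ∫⁻ y, f (Fin.cons a y) ∂(Measure.pi fun j => μ (Fin.succ j)) ∂(ν 0)
          + K * (δ * M 0) * ∏ j : Fin N, M (Fin.succ j) := by
            congr 1
            rw [lintegral_lintegral_swap]
            exact (hfm.comp measurable_swap).aemeasurable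
      _ ≤ ∫⁻ a, (∫⁻ y, f (Fin.cons a y) ∂(Measure.pi fun j => ν (Fin.succ j)) +
          K * N * δ * ∏ i : Fin N, M i.succ) ∂(ν 0)
          + K * (δ * M 0) * ∏ j : Fin N, M (Fin.succ j) := by
            gcongr with a; exact step2 a
      _ = ∫⁻ a, ∫⁻ y, f (Fin.cons a y) ∂(Measure.pi fun j => ν (Fin.succ j)) ∂(ν 0) +
          K * N * δ * (∏ i : Fin N, M i.succ) * ν 0 univ
          + K * (δ * M 0) * ∏ j : Fin N, M (Fin.succ j) := by
            rw [lintegral_add_right _ measurable_const, lintegral_const]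
      _ ≤ ∫⁻ a, ∫⁻ y, f (Fin.cons a y) ∂(Measure.pi fun j => ν (Fin.succ j)) ∂(ν 0) +
          K * N * δ * (∏ i : Fin N, M i.succ) * M 0
          + K * (δ * M 0) * ∏ j : Fin N, M (Fin.succ j) := by
            gcongr; exact hν 0
      _ = _ := by
            rw [Fin.prod_univ_succ]; push_cast; ring

lemma hybrid {ι : Type} [Fintype ι] [DecidableEq ι] (K : ℕ) (δ : ENNReal) (μ ν : ι → Measure ℝ)
    (hμf : ∀ i, IsFiniteMeasure (μ i)) (hνf : ∀ i, IsFiniteMeasure (ν i)) (M : ι → ENNReal)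
    (hμ : ∀ i, μ i univ ≤ M i) (hν : ∀ i, ν i univ ≤ M i)
    (hd : ∀ i, ∀ J : Set ℝ, J.OrdConnected → μ i J ≤ ν i J + δ * M i)
    (f : (ι → ℝ) → ENNReal) (hf : Measurable f)
    (hs : ∀ x i, IsIntv K (fun a => f (Function.update x i a))) :
    ∫⁻ x, f x ∂(Measure.pi μ) ≤
      ∫⁻ x, f x ∂(Measure.pi ν) + K * Fintype.card ι * δ * ∏ i, M i := by
  let e : Fin (Fintype.card ι) ≃ ι := (Fintype.equivFin ι).symm
  have e1 : ∀ m : ι → Measure ℝ, (∀ i, IsFiniteMeasure (m i)) →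
      ∫⁻ x, f x ∂(Measure.pi m) =
      ∫⁻ x, f (fun i => x (e.symm i)) ∂(Measure.pi fun j => m (e j)) := by
    intro m hm
    have h := measurePreserving_piCongrLeft m e
    rw [← h.lintegral_comp hf]
    refine lintegral_congr fun x => ?_
    congr 1; funext i
    obtain ⟨j, rfl⟩ := e.surjective i
    simp [MeasurableEquiv.coe_piCongrLeft, Equiv.piCongrLeft_apply_apply]
  rw [e1 μ hμf, e1 ν hνf]
  have hm : Measurable fun x : Fin (Fintype.card ι) → ℝ => (fun i => x (e.symm i)) := by
    fun_prop
  have := hybrid_fin K δ _ (fun j => μ (e j)) (fun j => ν (e j)) (fun _ => hμf _) (fun _ => hνf _)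
    (fun j => M (e j)) (fun _ => hμ _) (fun _ => hν _) (fun _ => hd _)
    (fun x => f (fun i => x (e.symm i))) (hf.comp hm) ?_
  · rwa [e.prod_comp] at this
  · intro x i
    convert hs (fun i => x (e.symm i)) (e i) using 3 with a
    funext k
    by_cases hk : k = e i
    · subst hk; simp
    · rw [Function.update_of_ne hk, Function.update_of_ne]
      intro h; apply hk; simp [← h]

/-- product of finitely supported measures -/
lemma pi_dirac {ι : Type} [Fintype ι] [DecidableEq ι] (A : ι → Finset ℝ) (c : ι → ENNReal)
    (hc : ∀ i, c i ≠ ⊤) :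
    Measure.pi (fun i => c i • ∑ α ∈ A i, Measure.dirac α) =
      (∏ i, c i) • ∑ x ∈ Fintype.piFinset A, Measure.dirac x := by
  have : ∀ i, IsFiniteMeasure (c i • ∑ α ∈ A i, Measure.dirac α) := by
    intro i
    refine ⟨?_⟩
    simp
    exact ENNReal.mul_lt_top (hc i).lt_top (by simp)
  refine Measure.pi_eq fun s hs => ?_
  simp only [Measure.smul_apply, Measure.finsetSum_apply, smul_eq_mul]
  rw [Finset.prod_mul_distrib, Finset.prod_univ_sum]
  congr 1
  refine Finset.sum_congr rfl fun x _ => ?_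
  rw [Measure.dirac_apply' _ (MeasurableSet.univ_pi hs)]
  simp_rw [Measure.dirac_apply' _ (hs _)]
  by_cases h : x ∈ univ.pi s
  · rw [indicator_of_mem h, Finset.prod_congr rfl (g := fun _ => 1)]; · simp
    intro i _; rw [indicator_of_mem (h i (mem_univ _))]; rfl
  · rw [indicator_of_notMem h]
    simp only [mem_univ_pi, not_forall] at h
    obtain ⟨i, hi⟩ := h
    symm; apply Finset.prod_eq_zero (Finset.mem_univ i); rw [indicator_of_notMem hi]

end

section

open Classical in
def cellIdx (T : Finset ℝ) (x : ℝ) : ℕ := (T.filter (· < x)).card + (T.filter (· ≤ x)).card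

lemma cellIdx_mono (T : Finset ℝ) : Monotone (cellIdx T) := by
  intro x y h
  unfold cellIdx
  gcongr

lemma cellIdx_le (T : Finset ℝ) (x : ℝ) : cellIdx T x ≤ 2 * T.card := by
  unfold cellIdx
  have h1 := Finset.card_filter_le T (· < x)
  have h2 := Finset.card_filter_le T (· ≤ x)
  omega

lemma cellIdx_no {T : Finset ℝ} {x y : ℝ} (hxy : x < y) (h : cellIdx T x = cellIdx T y)
    {t : ℝ} (ht : t ∈ T) (h1 : x ≤ t) (h2 : t ≤ y) : False := by
  classical
  unfold cellIdx at h
  have a1 : (T.filter (· < x)).card ≤ (T.filter (· < y)).card := by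
    apply Finset.card_le_card; intro a ha
    simp only [Finset.mem_filter] at ha ⊢; exact ⟨ha.1, by linarith⟩
  have a2 : (T.filter (· ≤ x)).card ≤ (T.filter (· ≤ y)).card := by
    apply Finset.card_le_card; intro a ha
    simp only [Finset.mem_filter] at ha ⊢; exact ⟨ha.1, by linarith⟩
  rcases h2.lt_or_eq with h3 | h3
  · have : (T.filter (· < x)).card < (T.filter (· < y)).card := by
      apply Finset.card_lt_card
      rw [Finset.ssubset_iff_of_subset]
      · exact ⟨t, by simp [ht, h3], by simp [h1]⟩
      · intro a ha
        simp only [Finset.mem_filter] at ha ⊢; exact ⟨ha.1, by linarith⟩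
    convert this.ne (by convert (by omega : (T.filter (· < x)).card = (T.filter (· < y)).card))
  · have : (T.filter (· ≤ x)).card < (T.filter (· ≤ y)).card := by
      apply Finset.card_lt_card
      rw [Finset.ssubset_iff_of_subset]
      · exact ⟨t, by simp [ht, h2], by simp; intro _; linarith⟩
      · intro a ha
        simp only [Finset.mem_filter] at ha ⊢; exact ⟨ha.1, by linarith⟩
    omega

lemma cell_ordConnected (T : Finset ℝ) (c : ℕ) : {x | cellIdx T x = c}.OrdConnected := by
  refine ⟨fun x hx y hy z hz => ?_⟩
  have h1 := cellIdx_mono T hz.1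
  have h2 := cellIdx_mono T hz.2
  simp only [mem_ofPred_eq] at *
  omega

lemma isIntv_of_cells (A : Set ℝ) (T : Finset ℝ) (m : ℕ) (hT : T.card ≤ m)
    (h : ∀ x y, x < y → cellIdx T x = cellIdx T y → (x ∈ A ↔ y ∈ A)) :
    IsIntv (2 * m + 1) (A.indicator fun _ => 1) := by
  refine ⟨fun c => A ∩ {x | cellIdx T x = c}, fun c => ?_, fun a => ?_⟩
  · refine ⟨fun x hx y hy z hz => ?_⟩
    have hc := (cell_ordConnected T c).out hx.2 hy.2 hz
    refine ⟨?_, hc⟩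
    rcases hz.1.eq_or_lt with h1 | h1
    · rw [← h1]; exact hx.1
    · exact (h x z h1 (by rw [hx.2, hc])).1 hx.1
  · have hlt : cellIdx T a < 2 * m + 1 := by
      have := cellIdx_le T a; omega
    rw [Finset.sum_eq_single (⟨cellIdx T a, hlt⟩ : Fin (2*m+1))]
    · by_cases ha : a ∈ A <;> simp [ha]
    · intro b _ hb
      rw [indicator_of_notMem]
      rintro ⟨_, h2⟩
      apply hb; ext; exact h2.symm
    · simp

lemma poly_sign_const (q : Polynomial ℝ) (x y : ℝ) (hxy : x < y)
    (h : ∀ t, q.eval t = 0 → x ≤ t → t ≤ y → False) :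
    (0 < q.eval x ↔ 0 < q.eval y) := by
  have hc : ContinuousOn (fun t => q.eval t) (Icc x y) := q.continuous.continuousOn
  constructor
  · intro hx
    by_contra hy
    push Not at hy
    obtain ⟨t, ht, h0⟩ := intermediate_value_Icc' hxy.le hc ⟨hy, hx.le⟩
    exact h t h0 ht.1 ht.2
  · intro hy
    by_contra hx
    push Not at hx
    obtain ⟨t, ht, h0⟩ := intermediate_value_Icc hxy.le hc ⟨hx, hy.le⟩
    exact h t h0 ht.1 ht.2

/-- one-dimensional semialgebraic sets -/
lemma isIntv_semialg (s p c : ℕ) (q : Fin s → Polynomial ℝ) (hq : ∀ i, (q i).natDegree ≤ p)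
    (sel : Fin c → Fin s → Option Bool) :
    IsIntv (2 * (s * p) + 1) (Set.indicator {a : ℝ | ∃ j, ∀ i, (sel j i).elim True
      (fun e => if e then (q i).eval a = 0 else 0 < (q i).eval a)} fun _ => 1) := by
  classical
  let T : Finset ℝ := Finset.univ.biUnion fun i => (q i).roots.toFinset
  have hT : T.card ≤ s * p := by
    refine Finset.card_biUnion_le.trans ?_
    calc ∑ i : Fin s, (q i).roots.toFinset.card ≤ ∑ i : Fin s, p := by
          refine Finset.sum_le_sum fun i _ => ?_
          exact (Multiset.toFinset_card_le _).trans (((q i).card_roots').trans (hq i))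
      _ = s * p := by simp
  refine isIntv_of_cells _ T _ hT fun x y hxy hc => ?_
  have hz : ∀ i, q i ≠ 0 → ∀ t, (q i).eval t = 0 → x ≤ t → t ≤ y → False := by
    intro i hi t ht h1 h2
    refine cellIdx_no hxy hc (t := t) ?_ h1 h2
    simp only [T, Finset.mem_biUnion, Finset.mem_univ, true_and]
    exact ⟨i, by simp [hi, ht]⟩
  have key : ∀ i, ((q i).eval x = 0 ↔ (q i).eval y = 0) ∧ (0 < (q i).eval x ↔ 0 < (q i).eval y) := by
    intro i
    by_cases hi : q i = 0
    · simp [hi]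
    · refine ⟨⟨fun h => (hz i hi x h le_rfl hxy.le).elim, fun h => (hz i hi y h hxy.le le_rfl).elim⟩, ?_⟩
      exact poly_sign_const _ _ _ hxy (hz i hi)
  simp only [mem_ofPred_eq, key]

/-- real polynomial with given coefficients -/
def rp {N : ℕ} (p : Fin N → ℝ) : Polynomial ℝ := ∑ i : Fin N, Polynomial.monomial (i : ℕ) (p i)

lemma rp_eval {N : ℕ} (p : Fin N → ℝ) (x : ℝ) : (rp p).eval x = ∑ i : Fin N, p i * x ^ (i : ℕ) := by
  simp [rp, Polynomial.eval_finsetSum]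

lemma rp_coeff {N : ℕ} (p : Fin N → ℝ) (k : ℕ) :
    (rp p).coeff k = if h : k < N then p ⟨k, h⟩ else 0 := by
  simp only [rp, Polynomial.finsetSum_coeff, Polynomial.coeff_monomial]
  split_ifs with h
  · rw [Finset.sum_eq_single ⟨k, h⟩]
    · simp
    · intro b _ hb
      rw [if_neg]; intro h'; apply hb; ext; exact h'
    · simp
  · apply Finset.sum_eq_zero
    intro b _
    rw [if_neg]; intro h'; apply h; rw [← h']; exact b.2

lemma rp_natDegree {N : ℕ} (p : Fin (N+1) → ℝ) : (rp p).natDegree ≤ N := by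
  rw [Polynomial.natDegree_le_iff_coeff_eq_zero]
  intro k hk
  rw [rp_coeff, dif_neg]; omega

lemma rp_eq_zero {N : ℕ} (p : Fin N → ℝ) : rp p = 0 ↔ p = 0 := by
  constructor
  · intro h; funext i
    have := rp_coeff p i
    rw [h] at this
    simpa using this.symm
  · rintro rfl; simp [rp]

lemma rp_update {N : ℕ} (p : Fin N → ℝ) (j : Fin N) (a : ℝ) :
    rp (Function.update p j a) = rp (Function.update p j 0) + Polynomial.monomial (j:ℕ) a := by
  ext k
  rw [Polynomial.coeff_add, rp_coeff, rp_coeff, Polynomial.coeff_monomial]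
  split_ifs with h1 h2 h2
  · have : (⟨k, h1⟩ : Fin N) = j := by ext; exact h2.symm
    rw [this]; simp
  · have : (⟨k, h1⟩ : Fin N) ≠ j := by intro h; apply h2; rw [← h]
    simp [this]
  · exact absurd j.2 (by omega)
  · simp

open Classical in
/-- number of distinct roots in `I` (zero for the zero polynomial) -/
def NI (I : Set ℝ) {N : ℕ} (p : Fin N → ℝ) : ℕ := ((rp p).roots.toFinset.filter (· ∈ I)).card

lemma NI_le (I : Set ℝ) {N : ℕ} (p : Fin (N+1) → ℝ) : NI I p ≤ N := by
  classical
  unfold NI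
  refine (Finset.card_filter_le _ _).trans ?_
  exact (Multiset.toFinset_card_le _).trans (((rp p).card_roots').trans (rp_natDegree p))

/-- if each cell contains at most one root -/
lemma NI_eq_sum (I : Set ℝ) {N : ℕ} (p : Fin N → ℝ) (hp : p ≠ 0) (T : Finset ℝ) (m : ℕ)
    (hT : T.card ≤ m)
    (h : ∀ x y, x < y → cellIdx T x = cellIdx T y → (rp p).eval x = 0 → (rp p).eval y = 0 → False) :
    (NI I p : ENNReal) = ∑ c : Fin (2 * m + 1),
      ({_u : Unit | ∃ x ∈ I, cellIdx T x = c ∧ (rp p).eval x = 0}.indicator (fun _ => 1) ()) := by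
  classical
  have hp' : rp p ≠ 0 := by rwa [Ne, rp_eq_zero]
  unfold NI
  rw [Finset.card_eq_sum_card_fiberwise (f := cellIdx T) (t := Finset.range (2*m+1))]
  · rw [Finset.sum_range, Nat.cast_sum]
    refine Finset.sum_congr rfl fun c _ => ?_
    by_cases hc : ∃ x ∈ I, cellIdx T x = c ∧ (rp p).eval x = 0
    · rw [indicator_of_mem (by exact hc)]
      obtain ⟨x, hxI, hxc, hx0⟩ := hc
      have : (Finset.filter (fun a => cellIdx T a = c)
          (Finset.filter (· ∈ I) (rp p).roots.toFinset)).card = 1 := by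
        rw [Finset.card_eq_one]
        refine ⟨x, ?_⟩
        ext y
        simp only [Finset.mem_filter, Multiset.mem_toFinset, Polynomial.mem_roots hp',
          Polynomial.IsRoot.def, Finset.mem_singleton]
        constructor
        · rintro ⟨⟨hy0, hyI⟩, hyc⟩
          rcases lt_trichotomy x y with hlt | heq | hlt
          · exact (h x y hlt (by rw [hxc, hyc]) hx0 hy0).elim
          · exact heq.symm
          · exact (h y x hlt (by rw [hxc, hyc]) hy0 hx0).elim
        · rintro rfl; exact ⟨⟨hx0, hxI⟩, hxc⟩
      rw [this]; simp
    · rw [indicator_of_notMem (by exact hc)]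
      simp only [Nat.cast_eq_zero, Finset.card_eq_zero]
      ext y
      simp only [Finset.mem_filter, Multiset.mem_toFinset, Polynomial.mem_roots hp',
          Polynomial.IsRoot.def]
      constructor
      · rintro ⟨⟨hy0, hyI⟩, hyc⟩; exact (hc ⟨y, hyI, hyc, hy0⟩).elim
      · simp
  · intro x _
    have := cellIdx_le T x
    simp; omega

end

section


lemma rolle_W (Q : Polynomial ℝ) (j : ℕ) (a x y : ℝ) (hxy : x < y)
    (h0 : ∀ z ∈ Icc x y, z ≠ 0)
    (hx : Q.eval x + a * x ^ j = 0) (hy : Q.eval y + a * y ^ j = 0) :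
    ∃ z ∈ Ioo x y, (Polynomial.X * Q.derivative - Polynomial.C (j : ℝ) * Q).eval z = 0 := by
  have hne : ∀ z ∈ Icc x y, z ^ j ≠ 0 := fun z hz => pow_ne_zero _ (h0 z hz)
  have hd : ∀ z ∈ Icc x y, HasDerivAt (fun z => Q.eval z / z ^ j)
      ((Q.derivative.eval z * z ^ j - Q.eval z * (j * z ^ (j - 1))) / (z ^ j) ^ 2) z := by
    intro z hz
    exact (Q.hasDerivAt z).div (hasDerivAt_pow j z) (hne z hz)
  have hval : ∀ z ∈ Icc x y, Q.eval z + a * z ^ j = 0 → Q.eval z / z ^ j = -a := by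
    intro z hz h
    rw [div_eq_iff (hne z hz)]; linarith
  obtain ⟨z, hz, hz0⟩ := exists_hasDerivAt_eq_zero hxy
    (f := fun z => Q.eval z / z ^ j) (fun z hz => (hd z hz).continuousAt.continuousWithinAt)
    (by
      rw [hval x (left_mem_Icc.2 hxy.le) hx, hval y (right_mem_Icc.2 hxy.le) hy])
    (fun z hz => hd z (Ioo_subset_Icc_self hz))
  refine ⟨z, hz, ?_⟩
  have hz' := Ioo_subset_Icc_self hz
  rw [div_eq_zero_iff] at hz0
  have hnum := hz0.resolve_right (pow_ne_zero _ (hne z hz'))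
  simp only [Polynomial.eval_sub, Polynomial.eval_mul, Polynomial.eval_X, Polynomial.eval_C]
  have e : (z:ℝ) * (j * z ^ (j-1)) = j * z ^ j := by
    cases j with
    | zero => simp
    | succ k => simp; ring
  have : z ^ j * (z * Q.derivative.eval z - j * Q.eval z) = 0 := by
    have : z ^ j * (z * Q.derivative.eval z - j * Q.eval z) =
      z * (Q.derivative.eval z * z ^ j) - Q.eval z * (j * z ^ j) := by ring
    rw [this, ← e]
    linear_combination z * hnum
  exact (mul_eq_zero.1 this).resolve_left (hne z hz')

lemma NI_slice (I : Set ℝ) (hI : I.OrdConnected) (d : ℕ) (p : Fin (d+1) → ℝ) (j : Fin (d+1)) :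
    IsIntv (2 * (d + 1) + 1) (fun a => (NI I (Function.update p j a) : ENNReal)) := by
  classical
  set p0 := Function.update p j 0 with hp0
  set Q := rp p0 with hQ
  have hQj : Q.coeff j = 0 := by rw [hQ, rp_coeff]; simp [hp0]
  have hP : ∀ a, rp (Function.update p j a) = Q + Polynomial.monomial (j:ℕ) a := rp_update p j
  by_cases hQ0 : Q = 0
  · -- degenerate case
    have hN : ∀ a, NI I (Function.update p j a) =
        if a ≠ 0 ∧ (0 : ℝ) ∈ I ∧ (j : ℕ) ≠ 0 then 1 else 0 := by
      intro a
      unfold NI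
      rw [hP, hQ0, zero_add]
      by_cases ha : a = 0
      · simp [ha]
      · rw [← Polynomial.C_mul_X_pow_eq_monomial, Polynomial.roots_C_mul_X_pow ha]
        by_cases hj : (j : ℕ) = 0
        · simp [hj]
        · rw [Multiset.toFinset_nsmul _ _ hj]
          simp [ha, hj, Finset.filter_singleton]
          split_ifs <;> simp
    by_cases hc : (0 : ℝ) ∈ I ∧ (j : ℕ) ≠ 0
    · refine ⟨fun c => if (c : ℕ) = 0 then Iio 0 else if (c : ℕ) = 1 then Ioi 0 else ∅, ?_, ?_⟩
      · intro c; dsimp only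
        split_ifs
        · exact ordConnected_Iio
        · exact ordConnected_Ioi
        · exact ordConnected_empty
      · intro a
        beta_reduce
        rw [hN, Fin.sum_univ_eq_sum_range (fun c => ((if c = 0 then Iio (0:ℝ) else if c = 1 then Ioi 0 else ∅).indicator (fun _ => (1:ENNReal)) a)),
          show 2 * (d + 1) + 1 = (2 * d + 1) + 1 + 1 by ring, Finset.sum_range_succ', Finset.sum_range_succ']
        simp only [hc, and_true, ne_eq, not_false_eq_true]
        rcases lt_trichotomy a 0 with h | h | h
        · simp [h.ne, h, h.le]
        · simp [h]
        · simp [h.ne', h, h.le]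
    · refine ⟨fun _ => ∅, fun _ => ordConnected_empty, fun a => ?_⟩
      beta_reduce
      rw [hN, if_neg (fun h => hc h.2)]; simp
  · set W := Polynomial.X * Q.derivative - Polynomial.C ((j : ℕ) : ℝ) * Q with hW
    have hWc : ∀ k, W.coeff k = ((k : ℝ) - (j : ℕ)) * Q.coeff k := by
      intro k
      rw [hW, Polynomial.coeff_sub, Polynomial.coeff_C_mul]
      cases k with
      | zero => simp
      | succ k => rw [Polynomial.coeff_X_mul, Polynomial.coeff_derivative]; push_cast; ring
    have hW0 : W ≠ 0 := by
      intro h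
      apply hQ0
      ext k
      by_cases hk : k = j
      · rw [hk, hQj]; simp
      · have := hWc k
        rw [h] at this
        have h2 : (k : ℝ) - (j : ℕ) ≠ 0 := by
          rw [sub_ne_zero]; exact_mod_cast hk
        simpa [h2] using this.symm
    have hWd : W.natDegree ≤ d := by
      rw [Polynomial.natDegree_le_iff_coeff_eq_zero]
      intro k hk
      rw [hWc, hQ, rp_coeff, dif_neg (by omega)]; simp
    let T : Finset ℝ := insert 0 W.roots.toFinset
    have hT : T.card ≤ d + 1 := by
      refine (Finset.card_insert_le _ _).trans ?_
      gcongr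
      exact (Multiset.toFinset_card_le _).trans ((W.card_roots').trans hWd)
    have hne : ∀ a, Function.update p j a ≠ 0 := by
      intro a h
      rw [← rp_eq_zero, hP] at h
      apply hQ0
      ext k
      by_cases hk : k = j
      · rw [hk, hQj]; simp
      · have := congrArg (fun q => Polynomial.coeff q k) h
        simp only [Polynomial.coeff_add, Polynomial.coeff_monomial, if_neg (Ne.symm hk)] at this
        simpa using this
    have hev : ∀ a x, (rp (Function.update p j a)).eval x = Q.eval x + a * x ^ (j : ℕ) := by
      intro a x; rw [hP]; simp
    refine ⟨fun c => {a | ∃ x ∈ I, cellIdx T x = c ∧ Q.eval x + a * x ^ (j:ℕ) = 0}, ?_, ?_⟩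
    · intro c
      by_cases hc : cellIdx T 0 = c
      · have hx0 : ∀ x, cellIdx T x = c → x = 0 := by
          intro x hx
          rcases lt_trichotomy x 0 with h | h | h
          · exact (cellIdx_no h (by rw [hx, hc]) (Finset.mem_insert_self _ _) h.le le_rfl).elim
          · exact h
          · exact (cellIdx_no h (by rw [hx, hc]) (Finset.mem_insert_self _ _) le_rfl h.le).elim
        refine ⟨?_⟩
        rintro a ⟨x, hxI, hxc, ha⟩ b ⟨y, hyI, hyc, hb⟩ z hz
        rw [hx0 x hxc] at ha hxI
        rw [hx0 y hyc] at hb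
        refine ⟨0, hxI, hc, ?_⟩
        by_cases hj : (j : ℕ) = 0
        · rw [hj] at ha hb ⊢
          have := hz.1; have := hz.2
          simp only [pow_zero, mul_one] at ha hb ⊢
          linarith
        · simp only [zero_pow hj, mul_zero] at ha hb ⊢; exact ha
      · have hne0 : ∀ x, cellIdx T x = c → x ≠ 0 := by
          rintro x hx rfl; exact hc hx
        have himg : {a | ∃ x ∈ I, cellIdx T x = c ∧ Q.eval x + a * x ^ (j:ℕ) = 0} =
            (fun x => - Q.eval x / x ^ (j:ℕ)) '' (I ∩ {x | cellIdx T x = c}) := by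
          ext a
          constructor
          · rintro ⟨x, hxI, hxc, hx⟩
            refine ⟨x, ⟨hxI, hxc⟩, ?_⟩
            change - Q.eval x / x ^ (j:ℕ) = a
            rw [div_eq_iff (pow_ne_zero _ (hne0 x hxc))]; linarith
          · rintro ⟨x, ⟨hxI, hxc⟩, hx⟩
            refine ⟨x, hxI, hxc, ?_⟩
            change - Q.eval x / x ^ (j:ℕ) = a at hx
            rw [div_eq_iff (pow_ne_zero _ (hne0 x hxc))] at hx; linarith
        beta_reduce
        rw [himg]
        apply IsPreconnected.ordConnected
        apply IsPreconnected.image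
        · exact (hI.inter (cell_ordConnected T c)).isPreconnected
        · apply ContinuousOn.div
          · exact Q.continuous.neg.continuousOn
          · exact (continuous_pow _).continuousOn
          · intro x hx; exact pow_ne_zero _ (hne0 x hx.2)
    · intro a
      have := NI_eq_sum I (Function.update p j a) (hne a) T (d+1) hT ?_
      · beta_reduce
        rw [this]
        refine Finset.sum_congr rfl fun c _ => ?_
        simp only [hev]
        by_cases h : ∃ x ∈ I, cellIdx T x = c ∧ Q.eval x + a * x ^ (j:ℕ) = 0
        · rw [indicator_of_mem (by exact h), indicator_of_mem (by exact h)]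
        · rw [indicator_of_notMem (by exact h), indicator_of_notMem (by exact h)]
      · intro x y hxy hcell hx hy
        rw [hev] at hx hy
        have h0 : ∀ z ∈ Icc x y, z ≠ 0 := by
          rintro z hz rfl
          exact cellIdx_no hxy hcell (Finset.mem_insert_self _ _) hz.1 hz.2
        obtain ⟨z, hz, hz0⟩ := rolle_W Q j a x y hxy h0 hx hy
        refine cellIdx_no hxy hcell (t := z) ?_ hz.1.le hz.2.le
        apply Finset.mem_insert_of_mem
        rw [Multiset.mem_toFinset, Polynomial.mem_roots hW0]
        exact hz0

lemma ordConnected_locallyClosed (I : Set ℝ) (hI : I.OrdConnected) : IsLocallyClosed I := by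
  have h : I ∈ {s : Set ℝ | IsPreconnected s} := hI.isPreconnected
  rw [setOfPred_isPreconnected_eq_of_ordered] at h
  have h1 : ∀ a b : ℝ, IsLocallyClosed (Ico a b) := fun a b =>
    ⟨Iio b, Ici a, isOpen_Iio, isClosed_Ici, by ext; simp [and_comm]⟩
  have h2 : ∀ a b : ℝ, IsLocallyClosed (Ioc a b) := fun a b =>
    ⟨Ioi a, Iic b, isOpen_Ioi, isClosed_Iic, by ext; simp⟩
  simp only [mem_union, mem_range, Prod.exists, Function.uncurry_apply_pair, mem_insert_iff,
    mem_singleton_iff] at h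
  rcases h with (((⟨a, b, rfl⟩ | ⟨a, b, rfl⟩) | ⟨a, b, rfl⟩) | ⟨a, b, rfl⟩) |
    ((((⟨a, rfl⟩ | ⟨a, rfl⟩) | ⟨a, rfl⟩) | ⟨a, rfl⟩) | (rfl | rfl))
  · exact isClosed_Icc.isLocallyClosed
  · exact h1 a b
  · exact h2 a b
  · exact isOpen_Ioo.isLocallyClosed
  · exact isClosed_Ici.isLocallyClosed
  · exact isOpen_Ioi.isLocallyClosed
  · exact isClosed_Iic.isLocallyClosed
  · exact isOpen_Iio.isLocallyClosed
  · exact isOpen_univ.isLocallyClosed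
  · exact isOpen_empty.isLocallyClosed

lemma measurable_hasRoot (I : Set ℝ) (hI : IsLocallyClosed I) (N : ℕ) (U : Set ℝ) (hU : IsOpen U) :
    MeasurableSet {p : Fin N → ℝ | ∃ x ∈ I, x ∈ U ∧ (rp p).eval x = 0} := by
  obtain ⟨O, Z, hO, hZ, rfl⟩ := hI
  obtain ⟨F, hFc, -, hF⟩ : ∃ F : ℕ → Set ℝ, (∀ n, IsCompact (F n)) ∧ True ∧ ⋃ n, F n = O ∩ U := by
    obtain ⟨F, hF, hF2⟩ := (show IsSigmaCompact (O ∩ U) from by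
      have := (hO.inter hU)
      obtain ⟨F, hF1, hF2, hF3, _⟩ := this.exists_iUnion_isClosed
      rw [← hF3]
      exact isSigmaCompact_iUnion _ fun n =>
        isSigmaCompact_univ.of_isClosed_subset (hF1 n) (subset_univ _))
    exact ⟨F, hF, trivial, hF2⟩
  have : {p : Fin N → ℝ | ∃ x ∈ O ∩ Z, x ∈ U ∧ (rp p).eval x = 0} =
      ⋃ n, {p | ∃ x ∈ F n ∩ Z, (rp p).eval x = 0} := by
    ext p
    simp only [mem_iUnion, mem_ofPred_eq]
    constructor
    · rintro ⟨x, ⟨hxO, hxZ⟩, hxU, hx⟩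
      have : x ∈ ⋃ n, F n := by rw [hF]; exact ⟨hxO, hxU⟩
      obtain ⟨n, hn⟩ := mem_iUnion.1 this
      exact ⟨n, x, ⟨hn, hxZ⟩, hx⟩
    · rintro ⟨n, x, ⟨hn, hxZ⟩, hx⟩
      have : x ∈ O ∩ U := by rw [← hF]; exact mem_iUnion.2 ⟨n, hn⟩
      exact ⟨x, ⟨this.1, hxZ⟩, this.2, hx⟩
  rw [this]
  refine MeasurableSet.iUnion fun n => ?_
  apply IsClosed.measurableSet
  have hK : IsCompact (F n ∩ Z) := (hFc n).inter_right hZ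
  have : CompactSpace ↑(F n ∩ Z) := isCompact_iff_compactSpace.1 hK
  have hcl : IsClosed {q : ↑(F n ∩ Z) × (Fin N → ℝ) | (rp q.2).eval (q.1 : ℝ) = 0} := by
    apply isClosed_eq _ continuous_const
    simp_rw [rp_eval]
    fun_prop
  have := isClosedMap_snd_of_compactSpace _ hcl
  convert this using 1
  ext p
  simp

lemma NI_measurable (I : Set ℝ) (hI : I.OrdConnected) (N : ℕ) :
    Measurable (fun p : Fin N → ℝ => NI I p) := by
  classical
  have hLC := ordConnected_locallyClosed I hI
  apply measurable_of_Ici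
  intro k
  let B := TopologicalSpace.countableBasis ℝ
  have hB : TopologicalSpace.IsTopologicalBasis B := TopologicalSpace.isBasis_countableBasis ℝ
  have hBc : Countable B := (TopologicalSpace.countable_countableBasis ℝ).to_subtype
  by_cases hk : k = 0
  · subst hk; simp
  have : (fun p : Fin N → ℝ => NI I p) ⁻¹' Ici k = {p | p ≠ 0} ∩
      ⋃ (s : Finset B) (_ : k ≤ s.card ∧ (s : Set B).PairwiseDisjoint (fun U => (U : Set ℝ))),
        ⋂ U ∈ s, {p | ∃ x ∈ I, x ∈ (U : Set ℝ) ∧ (rp p).eval x = 0} := by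
    ext p
    simp only [mem_preimage, mem_Ici, mem_inter_iff, mem_ofPred_eq, mem_iUnion, mem_iInter]
    constructor
    · intro h
      have hp : p ≠ 0 := by
        rintro rfl
        have : rp (0 : Fin N → ℝ) = 0 := by rw [rp_eq_zero]
        simp [NI, this] at h; omega
      refine ⟨hp, ?_⟩
      have hp' : rp p ≠ 0 := by rwa [Ne, rp_eq_zero]
      set R := (rp p).roots.toFinset.filter (· ∈ I) with hR
      obtain ⟨V, hV, hVd⟩ := (R.finite_toSet).t2_separation
      have : ∀ x : ℝ, ∃ U : B, x ∈ (U : Set ℝ) ∧ (U : Set ℝ) ⊆ V x := by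
        intro x
        obtain ⟨U, hU, hx, hUV⟩ := hB.exists_subset_of_mem_open (hV x).1 (hV x).2
        exact ⟨⟨U, hU⟩, hx, hUV⟩
      choose U hxU hUV using this
      have hdisj : ∀ x ∈ R, ∀ y ∈ R, x ≠ y → Disjoint (U x : Set ℝ) (U y : Set ℝ) := by
        intro x hx y hy hxy
        exact (hVd hx hy hxy).mono (hUV x) (hUV y)
      have hinj : Set.InjOn U R := by
        intro x hx y hy hxy
        by_contra hne
        have := hdisj x hx y hy hne
        rw [hxy] at this
        exact (Set.disjoint_left.1 this (hxU y)) (hxU y)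
      refine ⟨R.image U, ⟨?_, ?_⟩, ?_⟩
      · rw [Finset.card_image_of_injOn hinj]; exact h
      · intro A hA A' hA' hne
        simp only [Finset.coe_image, mem_image, Finset.mem_coe] at hA hA'
        obtain ⟨x, hx, rfl⟩ := hA
        obtain ⟨y, hy, rfl⟩ := hA'
        exact hdisj x hx y hy (fun h => hne (by rw [h]))
      · intro A hA
        rw [Finset.mem_image] at hA
        obtain ⟨x, hx, rfl⟩ := hA
        rw [hR, Finset.mem_filter, Multiset.mem_toFinset, Polynomial.mem_roots hp'] at hx
        exact ⟨x, hx.2, hxU x, hx.1⟩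
    · rintro ⟨hp, s, ⟨hs, hsd⟩, h⟩
      have hp' : rp p ≠ 0 := by rwa [Ne, rp_eq_zero]
      choose! x hxI hxU hx0 using h
      refine hs.trans ?_
      unfold NI
      apply Finset.card_le_card_of_injOn x
      · intro U hU
        simp only [Finset.coe_filter, Multiset.mem_toFinset, mem_ofPred_eq]
        rw [Polynomial.mem_roots hp']
        exact ⟨hx0 U hU, hxI U hU⟩
      · intro U hU U' hU' heq
        by_contra hne
        have := hsd hU hU' hne
        exact (Set.disjoint_left.1 this (hxU U hU)) (by rw [heq]; exact hxU U' hU')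
  rw [this]
  apply MeasurableSet.inter
  · exact (measurableSet_singleton (0 : Fin N → ℝ)).compl
  · refine MeasurableSet.iUnion fun s => MeasurableSet.iUnion fun _ => ?_
    refine Finset.measurableSet_biInter _ fun U _ => ?_
    exact measurable_hasRoot I hLC N U (hB.isOpen U.2)

end

section


def Qf (d : ℕ) (q : Fin d → ℝ) (x : ℝ) : ℝ := ∑ k : Fin d, q k * x ^ ((k : ℕ) + 1)
def Qf' (d : ℕ) (q : Fin d → ℝ) (x : ℝ) : ℝ := ∑ k : Fin d, (((k : ℕ) : ℝ) + 1) * q k * x ^ (k : ℕ)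

lemma rp_cons (d : ℕ) (q : Fin d → ℝ) (a x : ℝ) :
    (rp (Fin.cons a q : Fin (d+1) → ℝ)).eval x = a + Qf d q x := by
  rw [rp_eval, Fin.sum_univ_succ]; simp [Qf]

lemma Qf_hasDerivAt (d : ℕ) (q : Fin d → ℝ) (x : ℝ) : HasDerivAt (Qf d q) (Qf' d q x) x := by
  unfold Qf Qf'
  apply HasDerivAt.fun_sum
  intro k _
  have := (hasDerivAt_pow ((k:ℕ)+1) x).const_mul (q k)
  refine this.congr_deriv ?_
  push_cast; ring_nf
  try simp

lemma Qf'_roots (d : ℕ) (q : Fin d → ℝ) (hq : q ≠ 0) :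
    ∃ T : Finset ℝ, T.card ≤ d ∧ ∀ x, Qf' d q x = 0 → x ∈ T := by
  classical
  let r : Fin d → ℝ := fun k => (((k : ℕ) : ℝ) + 1) * q k
  have hr : r ≠ 0 := by
    intro h; apply hq; funext k
    have := congrFun h k
    simp only [r, Pi.zero_apply, mul_eq_zero] at this
    rcases this with h | h
    · exact absurd h (by positivity)
    · exact h
  refine ⟨(rp r).roots.toFinset, ?_, ?_⟩
  · refine (Multiset.toFinset_card_le _).trans (((rp r).card_roots').trans ?_)
    rw [Polynomial.natDegree_le_iff_coeff_eq_zero]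
    intro k hk
    rw [rp_coeff, dif_neg]; omega
  · intro x hx
    rw [Multiset.mem_toFinset, Polynomial.mem_roots (by rwa [Ne, rp_eq_zero]), Polynomial.IsRoot.def,
      rp_eval]
    exact hx

lemma area1 (d : ℕ) (q : Fin d → ℝ) (I : Set ℝ) (hI : I.OrdConnected) :
    ∫⁻ a in Icc (-1) 1, (NI I (Fin.cons a q : Fin (d+1) → ℝ) : ENNReal) =
    ∫⁻ x in I, ENNReal.ofReal |Qf' d q x| * (Icc (-1) 1).indicator (fun _ => 1) (Qf d q x) := by
  classical
  by_cases hq : q = 0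
  · have h1 : ∀ a, NI I (Fin.cons a q : Fin (d+1) → ℝ) = 0 := by
      intro a
      have : rp (Fin.cons a q : Fin (d+1) → ℝ) = Polynomial.C a := by
        subst hq
        simp [rp, Fin.sum_univ_succ]
      simp [NI, this]
    have h2 : ∀ x, Qf' d q x = 0 := by intro x; simp [Qf', hq]
    simp [h1, h2]
  · obtain ⟨T, hTc, hT⟩ := Qf'_roots d q hq
    have hcell : ∀ x y, x < y → cellIdx T x = cellIdx T y → Qf d q x = Qf d q y → False := by
      intro x y hxy hc hv
      obtain ⟨z, hz, hz0⟩ := exists_hasDerivAt_eq_zero hxy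
        (fun z _ => (Qf_hasDerivAt d q z).continuousAt.continuousWithinAt) hv
        (fun z _ => Qf_hasDerivAt d q z)
      exact cellIdx_no hxy hc (hT z hz0) hz.1.le hz.2.le
    let S : Fin (2 * d + 1) → Set ℝ := fun c => I ∩ {x | cellIdx T x = c}
    have hS : ∀ c, (S c).OrdConnected := fun c => hI.inter (cell_ordConnected T c)
    have hSm : ∀ c, MeasurableSet (S c) := fun c => (hS c).measurableSet
    have hcont : Continuous (Qf d q) := by unfold Qf; fun_prop
    have hJ : ∀ c, ((fun x => - Qf d q x) '' (S c)).OrdConnected := fun c =>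
      ((hS c).isPreconnected.image _ hcont.neg.continuousOn).ordConnected
    have hNI : ∀ a, (NI I (Fin.cons a q : Fin (d+1) → ℝ) : ENNReal) =
        ∑ c, ((fun x => - Qf d q x) '' (S c)).indicator (fun _ => 1) a := by
      intro a
      rw [NI_eq_sum I _ _ T d hTc]
      · refine Finset.sum_congr rfl fun c _ => ?_
        simp only [rp_cons]
        by_cases h : ∃ x ∈ I, cellIdx T x = c ∧ a + Qf d q x = 0
        · rw [indicator_of_mem (by exact h), indicator_of_mem]
          obtain ⟨x, hxI, hxc, hx⟩ := h
          exact ⟨x, ⟨hxI, hxc⟩, by change - Qf d q x = a; linarith⟩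
        · rw [indicator_of_notMem (by exact h), indicator_of_notMem]
          rintro ⟨x, ⟨hxI, hxc⟩, hx⟩
          change - Qf d q x = a at hx
          exact h ⟨x, hxI, hxc, by linarith⟩
      · intro x y hxy hc hx hy
        rw [rp_cons] at hx hy
        exact hcell x y hxy hc (by linarith)
      · intro h; apply hq; funext k
        have := congrFun h k.succ
        simpa using this
    simp_rw [hNI]
    rw [lintegral_finsetSum _ (fun c _ => measurable_const.indicator (hJ c).measurableSet)]
    have hc : ∀ c, ∫⁻ a in Icc (-1) 1, ((fun x => - Qf d q x) '' (S c)).indicator (fun _ => (1:ENNReal)) a =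
        ∫⁻ x in S c, ENNReal.ofReal |Qf' d q x| * (Icc (-1) 1).indicator (fun _ => 1) (Qf d q x) := by
      intro c
      have e1 : ∫⁻ a in Icc (-1:ℝ) 1, ((fun x => - Qf d q x) '' (S c)).indicator (fun _ => (1:ENNReal)) a =
          ∫⁻ a in (fun x => - Qf d q x) '' (S c), (Icc (-1:ℝ) 1).indicator (fun _ => (1:ENNReal)) a := by
        rw [← lintegral_indicator measurableSet_Icc, ← lintegral_indicator (hJ c).measurableSet]
        refine lintegral_congr fun a => ?_
        by_cases h1 : a ∈ Icc (-1:ℝ) 1 <;> by_cases h2 : a ∈ (fun x => - Qf d q x) '' (S c)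
        · rw [indicator_of_mem h1, indicator_of_mem h2, indicator_of_mem h2, indicator_of_mem h1]
        · rw [indicator_of_mem h1, indicator_of_notMem h2, indicator_of_notMem h2]
        · rw [indicator_of_notMem h1, indicator_of_mem h2, indicator_of_notMem h1]
        · rw [indicator_of_notMem h1, indicator_of_notMem h2]
      rw [e1, lintegral_image_eq_lintegral_abs_deriv_mul (f := fun x => - Qf d q x) (f' := fun x => - Qf' d q x) (hSm c)
        (fun x _ => (Qf_hasDerivAt d q x).neg.hasDerivWithinAt)]
      · refine lintegral_congr fun x => ?_
        rw [abs_neg]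
        congr 1
        by_cases h : Qf d q x ∈ Icc (-1:ℝ) 1
        · rw [indicator_of_mem h, indicator_of_mem]
          constructor <;> linarith [h.1, h.2]
        · rw [indicator_of_notMem h, indicator_of_notMem]
          intro h'; apply h
          constructor <;> linarith [h'.1, h'.2]
      · intro x hx y hy hxy
        have hv : Qf d q x = Qf d q y := by
          have : - Qf d q x = - Qf d q y := hxy
          linarith
        rcases lt_trichotomy x y with h | h | h
        · exact (hcell x y h (by rw [hx.2, hy.2]) hv).elim
        · exact h
        · exact (hcell y x h (by rw [hx.2, hy.2]) hv.symm).elim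
    rw [Finset.sum_congr rfl fun c _ => hc c]
    have hU : I = ⋃ c, S c := by
      ext x
      simp only [S, mem_iUnion, mem_inter_iff, mem_ofPred_eq]
      constructor
      · intro hx
        have := cellIdx_le T x
        exact ⟨⟨cellIdx T x, by omega⟩, hx, rfl⟩
      · rintro ⟨c, h, _⟩; exact h
    conv_rhs => rw [hU]
    rw [lintegral_iUnion hSm, tsum_fintype]
    intro c c' hcc'
    rw [Function.onFun, Set.disjoint_left]
    rintro x ⟨_, h1⟩ ⟨_, h2⟩
    apply hcc'; ext
    simp only [mem_ofPred_eq] at h1 h2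
    omega

/-- Lebesgue measure on `[-1,1]^N`. -/
def boxM (N : ℕ) (X : ℝ) : Measure (Fin N → ℝ) :=
  Measure.pi fun _ => volume.restrict (Icc (-X) X)

lemma boxM_eq (N : ℕ) (X : ℝ) : boxM N X = volume.restrict (univ.pi fun _ => Icc (-X) X) := by
  rw [boxM, ← Measure.restrict_pi_pi]; rfl

lemma DeltaDom_eq (d : ℕ) (x : ℝ) :
    DeltaDom d x = (univ.pi fun _ => Icc (-1) 1) ∩ {p | Qf d p x ∈ Icc (-1) 1} := by
  ext p
  simp only [DeltaDom, Qf, mem_ofPred_eq, mem_inter_iff, mem_univ_pi, abs_le, mem_Icc]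

lemma rho_lintegral (d : ℕ) (x : ℝ) : ENNReal.ofReal (rho d x) =
    ∫⁻ q, ENNReal.ofReal |Qf' d q x| * (Icc (-1) 1).indicator (fun _ => 1) (Qf d q x)
      ∂(boxM d 1) := by
  have hcl : IsClosed {p : Fin d → ℝ | Qf d p x ∈ Icc (-1:ℝ) 1} := by
    apply isClosed_Icc.preimage
    unfold Qf; fun_prop
  have hK : IsCompact (DeltaDom d x) := by
    rw [DeltaDom_eq]
    exact (isCompact_univ_pi fun _ => isCompact_Icc).inter_right hcl
  have h_int : IntegrableOn (fun q : Fin d → ℝ => |Qf' d q x|) (DeltaDom d x) := by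
    apply ContinuousOn.integrableOn_compact hK
    apply Continuous.continuousOn
    unfold Qf'; fun_prop
  have : rho d x = ∫ q in DeltaDom d x, |Qf' d q x| := rfl
  rw [this, ofReal_integral_eq_lintegral_ofReal h_int (by filter_upwards with q using abs_nonneg _),
    boxM_eq, DeltaDom_eq, inter_comm, ← Measure.restrict_restrict hcl.measurableSet,
    ← lintegral_indicator hcl.measurableSet]
  refine lintegral_congr fun q => ?_
  by_cases h : Qf d q x ∈ Icc (-1:ℝ) 1
  · rw [indicator_of_mem (by exact h), indicator_of_mem h, mul_one]
  · rw [indicator_of_notMem (by exact h), indicator_of_notMem h, mul_zero]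

lemma boxM_cons (N : ℕ) (X : ℝ) (f : (Fin (N+1) → ℝ) → ENNReal) (hf : Measurable f) :
    ∫⁻ p, f p ∂(boxM (N+1) X) = ∫⁻ q, (∫⁻ a in Icc (-X) X, f (Fin.cons a q)) ∂(boxM N X) := by
  have h := (measurePreserving_piFinSuccAbove (fun _ : Fin (N+1) => volume.restrict (Icc (-X) X)) 0).symm
  have h2 := h.lintegral_comp hf
  unfold boxM
  rw [← h2]
  simp only [piFinSucc_symm]
  exact lintegral_prod_symm' _ (hf.comp (measurable_cons N))

lemma Qf_meas (d : ℕ) : Measurable fun z : (Fin d → ℝ) × ℝ => 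
    ENNReal.ofReal |Qf' d z.1 z.2| * (Icc (-1:ℝ) 1).indicator (fun _ => 1) (Qf d z.1 z.2) := by
  have h1 : Continuous fun z : (Fin d → ℝ) × ℝ => Qf' d z.1 z.2 := by unfold Qf'; fun_prop
  have h2 : Continuous fun z : (Fin d → ℝ) × ℝ => Qf d z.1 z.2 := by unfold Qf; fun_prop
  apply Measurable.mul
  · exact (h1.abs.measurable).ennreal_ofReal
  · exact (measurable_const.indicator measurableSet_Icc).comp h2.measurable

lemma area (d : ℕ) (I : Set ℝ) (hI : I.OrdConnected) :
    ∫⁻ p, (NI I p : ENNReal) ∂(boxM (d+1) 1) = ∫⁻ x in I, ENNReal.ofReal (rho d x) := by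
  have hm : Measurable fun p : Fin (d+1) → ℝ => (NI I p : ENNReal) :=
    (measurable_of_countable (fun n : ℕ => (n : ENNReal))).comp (NI_measurable I hI (d+1))
  have : IsFiniteMeasure (boxM d 1) := by unfold boxM; infer_instance
  rw [boxM_cons _ _ _ hm]
  simp_rw [area1 d _ I hI, rho_lintegral]
  rw [lintegral_lintegral_swap]
  exact (Qf_meas d).aemeasurable

lemma rho_meas (d : ℕ) : Measurable fun x => ENNReal.ofReal (rho d x) := by
  have : IsFiniteMeasure (boxM d 1) := by unfold boxM; infer_instance
  simp_rw [rho_lintegral]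
  exact ((Qf_meas d).comp measurable_swap).lintegral_prod_right'

lemma rho_nonneg (d : ℕ) (x : ℝ) : 0 ≤ rho d x :=
  integral_nonneg fun _ => abs_nonneg _

lemma rho_measurable (d : ℕ) : Measurable (rho d) := by
  have := (rho_meas d).ennreal_toReal
  simpa [ENNReal.toReal_ofReal (rho_nonneg d _)] using this

lemma boxM_univ (N : ℕ) (X : ℝ) : boxM N X univ = ENNReal.ofReal (2 * X) ^ N := by
  rw [boxM, Measure.pi_univ]
  simp only [Measure.restrict_apply_univ, Real.volume_Icc, Finset.prod_const, Finset.card_univ,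
    Fintype.card_fin]
  ring_nf

lemma rho_total (d : ℕ) (I : Set ℝ) (hI : I.OrdConnected) :
    ∫⁻ x in I, ENNReal.ofReal (rho d x) ≤ d * 2 ^ (d + 1) := by
  rw [← area d I hI]
  calc ∫⁻ p, (NI I p : ENNReal) ∂(boxM (d+1) 1) ≤ ∫⁻ p, (d : ENNReal) ∂(boxM (d+1) 1) := by
        refine lintegral_mono fun p => ?_
        exact Nat.cast_le.2 (NI_le I p)
    _ = _ := by rw [lintegral_const, boxM_univ]; norm_num

end

section


lemma int_count (J : Set ℝ) (hJ : J.OrdConnected) (S : Finset ℤ) (hS : ∀ a : ℤ, a ∈ S ↔ (a : ℝ) ∈ J) :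
    (S.card : ENNReal) ≤ volume J + 1 ∧ volume J ≤ S.card + 1 := by
  rcases S.eq_empty_or_nonempty with h | h
  · subst h
    refine ⟨by simp, ?_⟩
    rcases J.eq_empty_or_nonempty with h0 | ⟨x, hx⟩
    · simp [h0]
    · have hsub : J ⊆ Icc (⌊x⌋ : ℝ) ((⌊x⌋ : ℝ) + 1) := by
        intro y hy
        constructor
        · by_contra hlt
          push Not at hlt
          have := hJ.out hy hx ⟨hlt.le, Int.floor_le x⟩
          have := (hS _).2 this
          simp at this
        · by_contra hlt
          push Not at hlt
          have : (((⌊x⌋ + 1 : ℤ)) : ℝ) ∈ J := hJ.out hx hy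
            ⟨by push_cast; exact (Int.lt_floor_add_one x).le, by push_cast; exact hlt.le⟩
          have := (hS _).2 this
          simp at this
      refine (measure_mono hsub).trans ?_
      simp [Real.volume_Icc]
  · set m := S.min' h
    set M := S.max' h
    have hm : (m : ℝ) ∈ J := (hS _).1 (S.min'_mem h)
    have hM : (M : ℝ) ∈ J := (hS _).1 (S.max'_mem h)
    have hmM : m ≤ M := S.min'_le _ (S.max'_mem h)
    have hSe : S = Finset.Icc m M := by
      ext a
      rw [Finset.mem_Icc]
      constructor
      · intro ha; exact ⟨S.min'_le _ ha, S.le_max' _ ha⟩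
      · rintro ⟨h1, h2⟩
        exact (hS a).2 (hJ.out hm hM ⟨by exact_mod_cast h1, by exact_mod_cast h2⟩)
    have hcard : (S.card : ENNReal) = ENNReal.ofReal ((M : ℝ) - m + 1) := by
      rw [hSe, Int.card_Icc]
      rw [← ENNReal.ofReal_natCast]
      congr 1
      have : ((M + 1 - m).toNat : ℤ) = M + 1 - m := Int.toNat_of_nonneg (by omega)
      have h2 : ((M + 1 - m).toNat : ℝ) = ((M + 1 - m : ℤ) : ℝ) := by exact_mod_cast this
      rw [h2]; push_cast; ring
    have hmMr : (m : ℝ) ≤ M := by exact_mod_cast hmM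
    have hsub1 : Icc (m : ℝ) M ⊆ J := hJ.out hm hM
    have hsub2 : J ⊆ Icc ((m : ℝ) - 1) (M + 1) := by
      intro y hy
      constructor
      · by_contra hlt
        push Not at hlt
        have : (((m - 1 : ℤ)) : ℝ) ∈ J := hJ.out hy hm ⟨by push_cast; exact hlt.le, by push_cast; linarith⟩
        have := S.min'_le _ ((hS _).2 this)
        change m ≤ m - 1 at this
        omega
      · by_contra hlt
        push Not at hlt
        have : (((M + 1 : ℤ)) : ℝ) ∈ J := hJ.out hM hy ⟨by push_cast; linarith, by push_cast; exact hlt.le⟩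
        have := S.le_max' _ ((hS _).2 this)
        change M + 1 ≤ M at this
        omega
    constructor
    · have := measure_mono (μ := volume) hsub1
      rw [Real.volume_Icc] at this
      rw [hcard, ENNReal.ofReal_add (by linarith) (by norm_num), ENNReal.ofReal_one]
      gcongr
    · refine (measure_mono hsub2).trans ?_
      rw [Real.volume_Icc, hcard, ← ENNReal.ofReal_one, ← ENNReal.ofReal_add (by linarith) (by norm_num)]
      apply ENNReal.ofReal_le_ofReal; linarith

def latA (h : ℕ) : Finset ℝ := (Finset.Icc (-(h : ℤ)) h).map ⟨fun a : ℤ => (a : ℝ), Int.cast_injective⟩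

def latM (h : ℕ) : Measure ℝ := (1 : ENNReal) • ∑ α ∈ latA h, Measure.dirac α

open Classical in
lemma latM_apply (h : ℕ) (J : Set ℝ) (hJ : MeasurableSet J) :
    latM h J = (((Finset.Icc (-(h : ℤ)) h).filter (fun a : ℤ => (a : ℝ) ∈ J)).card : ENNReal) := by
  classical
  rw [latM, one_smul, Measure.finsetSum_apply, latA, Finset.sum_map]
  simp only [Function.Embedding.coeFn_mk]
  simp_rw [Measure.dirac_apply' _ hJ]
  rw [Finset.card_filter, Nat.cast_sum]
  refine Finset.sum_congr rfl fun a _ => ?_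
  by_cases ha : (a : ℝ) ∈ J <;> simp [ha]

lemma lat_disc (h : ℕ) (X : ℝ) (h1 : (h : ℝ) ≤ X) (h2 : X < h + 1) (J : Set ℝ) (hJ : J.OrdConnected) :
    latM h J ≤ volume.restrict (Icc (-X) X) J + 1 ∧
    volume.restrict (Icc (-X) X) J ≤ latM h J + 1 := by
  classical
  rw [latM_apply h J hJ.measurableSet, Measure.restrict_apply hJ.measurableSet]
  apply int_count _ (hJ.inter ordConnected_Icc)
  intro a
  simp only [Finset.mem_filter, Finset.mem_Icc, mem_inter_iff, mem_Icc]
  have e1 : (-(h:ℤ) ≤ a ↔ -X ≤ (a:ℝ)) := by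
    constructor
    · intro h'
      have : (-(h:ℝ)) ≤ a := by exact_mod_cast h'
      linarith
    · intro h'
      have : (-((h:ℝ)+1)) < a := by linarith
      have : -((h:ℤ)+1) < a := by exact_mod_cast this
      omega
  have e2 : (a ≤ (h:ℤ) ↔ (a:ℝ) ≤ X) := by
    constructor
    · intro h'
      have : (a:ℝ) ≤ h := by exact_mod_cast h'
      linarith
    · intro h'
      have : (a:ℝ) < (h:ℝ)+1 := by linarith
      have : a < (h:ℤ)+1 := by exact_mod_cast this
      omega
  rw [e1, e2]; tauto

lemma NI_smul (I : Set ℝ) {N : ℕ} (p : Fin N → ℝ) (c : ℝ) (hc : c ≠ 0) : NI I (c • p) = NI I p := by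
  unfold NI
  have : rp (c • p) = Polynomial.C c * rp p := by
    unfold rp
    rw [Finset.mul_sum]
    simp [Polynomial.C_mul_monomial]
  rw [this, Polynomial.roots_C_mul _ hc]

lemma NI_meas_enn (I : Set ℝ) (hI : I.OrdConnected) (N : ℕ) :
    Measurable fun p : Fin N → ℝ => (NI I p : ENNReal) :=
  (measurable_of_countable (fun n : ℕ => (n : ENNReal))).comp (NI_measurable I hI N)

lemma box_scale (I : Set ℝ) (hI : I.OrdConnected) (N : ℕ) (X : ℝ) (hX : 0 < X) :
    ∫⁻ p, (NI I p : ENNReal) ∂(boxM N X) =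
      ENNReal.ofReal (X ^ N) * ∫⁻ p, (NI I p : ENNReal) ∂(boxM N 1) := by
  have hm := NI_meas_enn I hI N
  have hms : ∀ X : ℝ, MeasurableSet (univ.pi fun _ : Fin N => Icc (-X) X) := fun X =>
    MeasurableSet.univ_pi fun _ => measurableSet_Icc
  have hmap := Measure.map_addHaar_smul (volume : Measure (Fin N → ℝ)) hX.ne'
  rw [boxM_eq, boxM_eq, ← lintegral_indicator (hms X), ← lintegral_indicator (hms 1)]
  have e : ∀ p : Fin N → ℝ, (univ.pi fun _ : Fin N => Icc (-1:ℝ) 1).indicator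
      (fun p => (NI I p : ENNReal)) p =
      (univ.pi fun _ : Fin N => Icc (-X) X).indicator (fun p => (NI I p : ENNReal)) (X • p) := by
    intro p
    have hiff : p ∈ (univ.pi fun _ : Fin N => Icc (-1:ℝ) 1) ↔ X • p ∈ (univ.pi fun _ : Fin N => Icc (-X) X) := by
      simp only [mem_univ_pi, mem_Icc, Pi.smul_apply, smul_eq_mul]
      refine forall_congr' fun i => ?_
      constructor
      · rintro ⟨h1, h2⟩; constructor <;> nlinarith
      · rintro ⟨h1, h2⟩
        constructor
        · by_contra h; push Not at h; nlinarith
        · by_contra h; push Not at h; nlinarith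
    by_cases h : p ∈ (univ.pi fun _ : Fin N => Icc (-1:ℝ) 1)
    · rw [indicator_of_mem h, indicator_of_mem (hiff.1 h), NI_smul I p X hX.ne']
    · rw [indicator_of_notMem h, indicator_of_notMem (fun h' => h (hiff.2 h'))]
  simp_rw [e]
  rw [← lintegral_map (f := fun p => (univ.pi fun _ : Fin N => Icc (-X) X).indicator (fun p => (NI I p : ENNReal)) p)
    (hm.indicator (hms X)) (measurable_const_smul X)]
  erw [hmap]
  rw [lintegral_smul_measure, smul_eq_mul, ← mul_assoc]
  simp only [Module.finrank_fintype_fun_eq_card, Fintype.card_fin]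
  rw [← ENNReal.ofReal_mul (by positivity), abs_of_pos (by positivity), mul_inv_cancel₀ (by positivity)]
  simp

/-- sum over integer polynomials of height at most `h` of the number of roots in `I` -/
def Lsum (I : Set ℝ) (d h : ℕ) : ℕ :=
  ∑ a ∈ Fintype.piFinset (fun _ : Fin (d+1) => Finset.Icc (-(h:ℤ)) h), NI I (fun i => (a i : ℝ))

def Arho (I : Set ℝ) (d : ℕ) : ℝ := (∫⁻ x in I, ENNReal.ofReal (rho d x)).toReal

lemma Lsum_lintegral (I : Set ℝ) (hI : I.OrdConnected) (d h : ℕ) :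
    ∫⁻ p, (NI I p : ENNReal) ∂(Measure.pi fun _ : Fin (d+1) => latM h) = Lsum I d h := by
  classical
  unfold latM
  rw [pi_dirac _ _ (by simp)]
  simp only [Finset.prod_const_one, one_smul]
  rw [lintegral_finsetSum_measure]
  simp_rw [lintegral_dirac' _ (NI_meas_enn I hI (d+1))]
  unfold Lsum
  rw [Nat.cast_sum]
  symm
  refine Finset.sum_bij (fun a _ i => (a i : ℝ)) ?_ ?_ ?_ ?_
  · intro a ha
    rw [Fintype.mem_piFinset] at ha ⊢
    intro i
    exact Finset.mem_map_of_mem _ (ha i)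
  · intro a _ b _ hab
    funext i
    exact_mod_cast congrFun hab i
  · intro x hx
    rw [Fintype.mem_piFinset] at hx
    have : ∀ i, ∃ a : ℤ, a ∈ Finset.Icc (-(h:ℤ)) h ∧ (a:ℝ) = x i := by
      intro i
      have := hx i
      rw [latA, Finset.mem_map] at this
      exact this
    choose a ha hax using this
    exact ⟨a, by rwa [Fintype.mem_piFinset], funext hax⟩
  · intro a _; rfl

lemma Arho_ofReal (I : Set ℝ) (hI : I.OrdConnected) (d : ℕ) :
    ENNReal.ofReal (Arho I d) = ∫⁻ x in I, ENNReal.ofReal (rho d x) := by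
  apply ENNReal.ofReal_toReal
  refine ne_top_of_le_ne_top ?_ (rho_total d I hI)
  finiteness

lemma Arho_le (I : Set ℝ) (hI : I.OrdConnected) (d : ℕ) : Arho I d ≤ d * 2 ^ (d+1) := by
  have := rho_total d I hI
  rw [← Arho_ofReal I hI] at this
  have h2 : (d * 2 ^ (d+1) : ENNReal) = ENNReal.ofReal (d * 2 ^ (d+1)) := by
    rw [ENNReal.ofReal_mul (by positivity), ENNReal.ofReal_pow (by norm_num)]; simp
  rw [h2] at this
  exact (ENNReal.ofReal_le_ofReal_iff (by positivity)).1 this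

lemma Arho_nonneg (I : Set ℝ) (d : ℕ) : 0 ≤ Arho I d := ENNReal.toReal_nonneg

lemma lattice_count (I : Set ℝ) (hI : I.OrdConnected) (d h : ℕ) (X : ℝ) (h1 : (h : ℝ) ≤ X)
    (h2 : X < h + 1) (hX : 1 ≤ X) :
    |(Lsum I d h : ℝ) - X ^ (d+1) * Arho I d| ≤ (2 * d + 3) * (d + 1) * 3 ^ d * X ^ d := by
  have hX0 : 0 < X := by linarith
  set δ : ENNReal := ENNReal.ofReal (1 / (3 * X)) with hδ
  set M : ENNReal := ENNReal.ofReal (3 * X) with hM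
  have hδM : δ * M = 1 := by
    rw [hδ, hM, ← ENNReal.ofReal_mul (by positivity), one_div, inv_mul_cancel₀ (by positivity),
      ENNReal.ofReal_one]
  have hfin : IsFiniteMeasure (latM h) := by
    refine ⟨?_⟩
    rw [latM_apply _ _ MeasurableSet.univ]; exact ENNReal.natCast_lt_top _
  have hl : latM h univ ≤ M := by
    rw [latM_apply _ _ MeasurableSet.univ]
    simp only [mem_univ, Finset.filter_true, Int.card_Icc]
    rw [hM, ← ENNReal.ofReal_natCast]
    apply ENNReal.ofReal_le_ofReal
    have : ((h:ℤ) + 1 - -(h:ℤ)).toNat = 2 * h + 1 := by omega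
    rw [this]; push_cast; linarith
  have hv : volume.restrict (Icc (-X) X) univ ≤ M := by
    simp only [Measure.restrict_apply_univ, Real.volume_Icc, hM]
    apply ENNReal.ofReal_le_ofReal; linarith
  have hd := lat_disc h X h1 h2
  have hm := NI_meas_enn I hI (d+1)
  have hE : ((2 * (d+1) + 1 : ℕ) : ENNReal) * ((d + 1 : ℕ) : ENNReal) * δ * ∏ i : Fin (d+1), M =
      ENNReal.ofReal ((2 * d + 3) * (d + 1) * 3 ^ d * X ^ d) := by
    rw [Finset.prod_const, Finset.card_univ, Fintype.card_fin, pow_succ', mul_assoc, ← mul_assoc δ, hδM, one_mul,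
      hM, ← ENNReal.ofReal_pow (by positivity), ← ENNReal.ofReal_natCast, ← ENNReal.ofReal_natCast,
      ← ENNReal.ofReal_mul (by positivity), ← ENNReal.ofReal_mul (by positivity)]
    congr 1
    rw [mul_pow]; push_cast; ring
  have k1 := hybrid_fin (2 * (d+1) + 1) δ (d+1) (fun _ => latM h) (fun _ => volume.restrict (Icc (-X) X))
    (fun _ => hfin) (fun _ => inferInstance) (fun _ => M) (fun _ => hl) (fun _ => hv)
    (fun _ J hJ => by rw [hδM]; exact (hd J hJ).1) (fun p => (NI I p : ENNReal)) hm
    (fun p j => NI_slice I hI d p j)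
  have k2 := hybrid_fin (2 * (d+1) + 1) δ (d+1) (fun _ => volume.restrict (Icc (-X) X)) (fun _ => latM h)
    (fun _ => inferInstance) (fun _ => hfin) (fun _ => M) (fun _ => hv) (fun _ => hl)
    (fun _ J hJ => by rw [hδM]; exact (hd J hJ).2) (fun p => (NI I p : ENNReal)) hm
    (fun p j => NI_slice I hI d p j)
  have e2 : ∫⁻ p, (NI I p : ENNReal) ∂(Measure.pi fun _ : Fin (d+1) => volume.restrict (Icc (-X) X)) =
      ENNReal.ofReal (X ^ (d+1) * Arho I d) := by
    have := box_scale I hI (d+1) X hX0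
    rw [area d I hI, ← Arho_ofReal I hI, ← ENNReal.ofReal_mul (by positivity)] at this
    exact this
  have hA := Arho_nonneg I d
  rw [hE, Lsum_lintegral I hI, e2, ← ENNReal.ofReal_natCast, ← ENNReal.ofReal_add (by positivity) (by positivity),
    ENNReal.ofReal_le_ofReal_iff (by positivity)] at k1 k2
  rw [abs_le]; constructor <;> linarith

end

section


def ibox (d h : ℕ) : Finset (Fin (d+1) → ℤ) :=
  Fintype.piFinset (fun _ : Fin (d+1) => Finset.Icc (-(h:ℤ)) h)

lemma mem_ibox (d h : ℕ) (a : Fin (d+1) → ℤ) : a ∈ ibox d h ↔ ∀ i, |a i| ≤ h := by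
  simp [ibox, Fintype.mem_piFinset, Finset.mem_Icc, abs_le]

/-- sum over primitive integer vectors of the number of roots in `I` -/
def Prim (I : Set ℝ) (d h : ℕ) : ℕ :=
  ∑ a ∈ (ibox d h).filter (fun a => Finset.univ.gcd a = 1), NI I (fun i => (a i : ℝ))

lemma NI_zero (I : Set ℝ) (N : ℕ) : NI I (fun _ : Fin N => (0:ℝ)) = 0 := by
  have : rp (fun _ : Fin N => (0:ℝ)) = 0 := by simp [rp]
  simp [NI, this]

lemma moebius_sum (g : ℕ) (hg : g ≠ 0) (H : ℕ) (hgH : g ≤ H) :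
    ∑ k ∈ (Finset.Icc 1 H).filter (fun k => k ∣ g), ArithmeticFunction.moebius k = if g = 1 then 1 else 0 := by
  have h1 : (Finset.Icc 1 H).filter (fun k => k ∣ g) = g.divisors := by
    ext k
    simp only [Finset.mem_filter, Finset.mem_Icc, Nat.mem_divisors]
    constructor
    · rintro ⟨_, h⟩; exact ⟨h, hg⟩
    · rintro ⟨h, _⟩
      exact ⟨⟨Nat.pos_of_dvd_of_pos h (Nat.pos_of_ne_zero hg),
        (Nat.le_of_dvd (Nat.pos_of_ne_zero hg) h).trans hgH⟩, h⟩
  rw [h1]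
  have := congrArg (fun f => f g) ArithmeticFunction.moebius_mul_coe_zeta
  simp only [ArithmeticFunction.coe_mul_zeta_apply, ArithmeticFunction.one_apply] at this
  exact this

lemma Lsum_div (I : Set ℝ) (d H k : ℕ) (hk : 1 ≤ k) :
    Lsum I d (H / k) = ∑ a ∈ (ibox d H).filter (fun a => ∀ i, (k:ℤ) ∣ a i), NI I (fun i => (a i : ℝ)) := by
  unfold Lsum
  change ∑ a ∈ ibox d (H/k), _ = _
  refine Finset.sum_bij (fun b _ i => (k:ℤ) * b i) ?_ ?_ ?_ ?_
  · intro b hb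
    rw [mem_ibox] at hb
    rw [Finset.mem_filter, mem_ibox]
    refine ⟨fun i => ?_, fun i => dvd_mul_right _ _⟩
    rw [abs_mul, Nat.abs_cast]
    calc (k:ℤ) * |b i| ≤ k * ((H/k : ℕ):ℤ) := by gcongr; exact hb i
      _ ≤ H := by exact_mod_cast Nat.mul_div_le H k
  · intro b _ c _ h
    funext i
    have := congrFun h i
    have hk0 : (k:ℤ) ≠ 0 := by omega
    exact mul_left_cancel₀ hk0 this
  · intro a ha
    rw [Finset.mem_filter, mem_ibox] at ha
    choose b hb using ha.2
    refine ⟨b, ?_, funext fun i => (hb i).symm⟩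
    rw [mem_ibox]
    intro i
    have := ha.1 i
    rw [hb i, abs_mul, Nat.abs_cast] at this
    push_cast
    rw [Int.le_ediv_iff_mul_le (by omega)]
    linarith
  · intro b _
    have := NI_smul I (fun i => (b i : ℝ)) (k:ℝ) (by positivity)
    rw [← this]
    congr 1
    funext i; simp

lemma Prim_eq (I : Set ℝ) (d H : ℕ) :
    (Prim I d H : ℤ) = ∑ k ∈ Finset.Icc 1 H, ArithmeticFunction.moebius k * (Lsum I d (H / k) : ℤ) := by
  classical
  have e1 : ∀ k ∈ Finset.Icc 1 H, ArithmeticFunction.moebius k * (Lsum I d (H / k) : ℤ) =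
      ∑ a ∈ ibox d H, (if (∀ i, (k:ℤ) ∣ a i) then ArithmeticFunction.moebius k else 0) * (NI I (fun i => (a i : ℝ)) : ℤ) := by
    intro k hk
    rw [Lsum_div I d H k (Finset.mem_Icc.1 hk).1, Finset.sum_filter]
    push_cast
    rw [Finset.mul_sum]
    refine Finset.sum_congr rfl fun a _ => ?_
    split_ifs <;> simp
  rw [Finset.sum_congr rfl e1, Finset.sum_comm, Prim, Finset.sum_filter]
  push_cast
  refine Finset.sum_congr rfl fun a ha => ?_
  rw [← Finset.sum_mul]
  by_cases h0 : a = 0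
  · subst h0
    have := NI_zero I (d+1)
    simp [this]
  · set g := Finset.univ.gcd a with hg
    have hg0 : g ≠ 0 := by
      intro h
      rw [hg, Finset.gcd_eq_zero_iff] at h
      exact h0 (funext fun i => h i (Finset.mem_univ i))
    have hgn : (g.natAbs : ℤ) = g := by
      have : normalize g = g := by rw [hg]; exact Finset.normalize_gcd
      rw [← Int.abs_eq_normalize] at this
      rw [Int.natCast_natAbs, this]
    have hdv : ∀ k : ℕ, (∀ i, (k:ℤ) ∣ a i) ↔ k ∣ g.natAbs := by
      intro k
      rw [← Int.natCast_dvd_natCast, hgn, hg, Finset.dvd_gcd_iff]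
      simp
    have hle : g.natAbs ≤ H := by
      obtain ⟨i, hi⟩ : ∃ i, a i ≠ 0 := by
        by_contra h; push Not at h; exact h0 (funext h)
      have h1 : g ∣ a i := Finset.gcd_dvd (Finset.mem_univ i)
      have h2 : g.natAbs ≤ (a i).natAbs := Nat.le_of_dvd (Int.natAbs_pos.2 hi) (Int.natAbs_dvd_natAbs.2 h1)
      have h3 := (mem_ibox d H a).1 ha i
      rw [abs_le] at h3
      omega
    have := moebius_sum g.natAbs (by simpa using hg0) H hle
    simp_rw [hdv]
    rw [← Finset.sum_filter, this]
    have hiff : g.natAbs = 1 ↔ g = 1 := by omega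
    simp only [hiff]
    split_ifs <;> simp

lemma sum_inv_sq_Ioc (H N : ℕ) (hH : 1 ≤ H) : ∑ k ∈ Finset.Ioc H N, (1:ℝ) / (k:ℝ)^2 ≤ 1 / H := by
  rcases le_total H N with h | h
  · have := sum_Ioc_inv_sq_le_sub (α := ℝ) (k := H) (n := N) (by omega) h
    have h2 : (0:ℝ) ≤ (N:ℝ)⁻¹ := by positivity
    simp only [one_div]
    linarith
  · rw [Finset.Ioc_eq_empty_of_le h]; simp

lemma sum_inv_sq_Icc (N : ℕ) : ∑ k ∈ Finset.Icc 1 N, (1:ℝ) / (k:ℝ)^2 ≤ 2 := by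
  rcases Nat.eq_zero_or_pos N with h | h
  · subst h; simp
  · rw [← Finset.add_sum_Ioc_eq_sum_Icc (by omega : 1 ≤ N)]
    have := sum_inv_sq_Ioc 1 N le_rfl
    norm_num at this ⊢
    linarith

lemma zetaR_summable (s : ℕ) (hs : 2 ≤ s) : Summable fun n : ℕ => (1:ℝ) / ((n:ℝ)+1)^s := by
  have := (summable_nat_add_iff 1).2 (Real.summable_one_div_nat_pow.2 (by omega : 1 < s))
  simpa using this

lemma zetaR_ge (s : ℕ) (hs : 2 ≤ s) : 1 ≤ zetaR s := by
  have := (zetaR_summable s hs).le_tsum 0 (fun n _ => by positivity)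
  simpa [zetaR] using this

lemma moebius_hasSum (s : ℕ) (hs : 2 ≤ s) :
    HasSum (fun k : ℕ => (ArithmeticFunction.moebius k : ℝ) / (k:ℝ)^s) (1 / zetaR s) := by
  have hsum : Summable (fun k : ℕ => (ArithmeticFunction.moebius k : ℝ) / (k:ℝ)^s) := by
    refine Summable.of_norm_bounded (Real.summable_one_div_nat_pow.2 (by omega : 1 < s)) fun k => ?_
    rw [norm_div, norm_pow, Real.norm_natCast]
    gcongr
    have := ArithmeticFunction.abs_moebius_le_one (n := k)
    rw [Real.norm_eq_abs]; exact_mod_cast this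
  have hre : 1 < ((s:ℕ):ℂ).re := by simp; omega
  have h1 := ArithmeticFunction.LSeries_zeta_mul_Lseries_moebius hre
  rw [ArithmeticFunction.LSeries_zeta_eq_riemannZeta hre, zeta_nat_eq_tsum_of_gt_one (by omega)] at h1
  have hz : (∑' n : ℕ, 1 / (n:ℂ)^s) = (zetaR s : ℂ) := by
    have hS := Real.summable_one_div_nat_pow.2 (by omega : 1 < s)
    have : (∑' n : ℕ, (1:ℝ) / (n:ℝ)^s) = zetaR s := by
      rw [hS.tsum_eq_zero_add]
      simp [zetaR, show s ≠ 0 by omega]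
    rw [← this]; push_cast; rfl
  have hmu : LSeries (fun n => ((ArithmeticFunction.moebius n : ℤ) : ℂ)) (s:ℂ) =
      ((∑' k : ℕ, (ArithmeticFunction.moebius k : ℝ) / (k:ℝ)^s : ℝ) : ℂ) := by
    rw [LSeries, Complex.ofReal_tsum]
    congr 1
    funext k
    rw [LSeries.term_def]
    split_ifs with h
    · subst h; simp
    · rw [Complex.cpow_natCast]; push_cast; rfl
  rw [hz, hmu] at h1
  have h2 : zetaR s * (∑' k : ℕ, (ArithmeticFunction.moebius k : ℝ) / (k:ℝ)^s) = 1 := by exact_mod_cast h1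
  have hz0 : zetaR s ≠ 0 := by have := zetaR_ge s hs; linarith
  have h3 : (∑' k : ℕ, (ArithmeticFunction.moebius k : ℝ) / (k:ℝ)^s) = 1 / zetaR s := by
    field_simp; linarith
  rw [← h3]; exact hsum.hasSum

lemma moebius_tail (s : ℕ) (hs : 2 ≤ s) (H : ℕ) (hH : 1 ≤ H) :
    |∑ k ∈ Finset.Icc 1 H, (ArithmeticFunction.moebius k : ℝ) / (k:ℝ)^s - 1 / zetaR s| ≤ 1 / H := by
  have h1 := (moebius_hasSum s hs).tendsto_sum_nat
  have h2 := ((tendsto_const_nhds (x := ∑ k ∈ Finset.Icc 1 H, (ArithmeticFunction.moebius k : ℝ) / (k:ℝ)^s)).sub h1).abs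
  refine le_of_tendsto h2 ?_
  filter_upwards [Filter.eventually_ge_atTop (H+1)] with N hN
  have e : ∑ k ∈ Finset.range N, (ArithmeticFunction.moebius k : ℝ) / (k:ℝ)^s =
      ∑ k ∈ Finset.Icc 1 H, (ArithmeticFunction.moebius k : ℝ) / (k:ℝ)^s +
      ∑ k ∈ Finset.Ioc H (N-1), (ArithmeticFunction.moebius k : ℝ) / (k:ℝ)^s := by
    have hr : Finset.range N = insert 0 (Finset.Icc 1 H ∪ Finset.Ioc H (N-1)) := by
      ext k; simp only [Finset.mem_range, Finset.mem_insert, Finset.mem_union, Finset.mem_Icc, Finset.mem_Ioc]; omega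
    rw [hr, Finset.sum_insert (by simp), Finset.sum_union]
    · simp
    · rw [Finset.disjoint_left]; intro k; simp only [Finset.mem_Icc, Finset.mem_Ioc]; omega
  rw [e]
  rw [sub_add_cancel_left, abs_neg]
  refine (Finset.abs_sum_le_sum_abs _ _).trans ((Finset.sum_le_sum fun k hk => ?_).trans (sum_inv_sq_Ioc H (N-1) hH))
  have hk1 : 1 ≤ k := by rw [Finset.mem_Ioc] at hk; omega
  have hk1' : (1:ℝ) ≤ k := by exact_mod_cast hk1
  rw [abs_div, abs_of_pos (by positivity : (0:ℝ) < (k:ℝ)^s)]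
  have hmu : |(ArithmeticFunction.moebius k : ℝ)| ≤ 1 := by
    have := ArithmeticFunction.abs_moebius_le_one (n := k)
    exact_mod_cast this
  gcongr

lemma prim_count (I : Set ℝ) (hI : I.OrdConnected) (d H : ℕ) (hd : 2 ≤ d) (hH : 1 ≤ H) :
    |(Prim I d H : ℝ) - (H:ℝ) ^ (d+1) * Arho I d / zetaR (d+1)| ≤
      (2 * ((2 * d + 3) * (d + 1) * 3 ^ d) + d * 2^(d+1)) * (H:ℝ) ^ d := by
  have hH' : (1:ℝ) ≤ H := by exact_mod_cast hH
  have hP : (Prim I d H : ℝ) = ∑ k ∈ Finset.Icc 1 H, (ArithmeticFunction.moebius k : ℝ) * (Lsum I d (H / k) : ℝ) := by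
    have := Prim_eq I d H
    exact_mod_cast this
  set C : ℝ := (2 * d + 3) * (d + 1) * 3 ^ d with hC
  have hC0 : 0 ≤ C := by positivity
  have hA := Arho_nonneg I d
  have hA2 := Arho_le I hI d
  have hmu : ∀ k, |(ArithmeticFunction.moebius k : ℝ)| ≤ 1 := by
    intro k
    have := ArithmeticFunction.abs_moebius_le_one (n := k)
    exact_mod_cast this
  have h1 : |(Prim I d H : ℝ) - (H:ℝ) ^ (d+1) * Arho I d * ∑ k ∈ Finset.Icc 1 H, (ArithmeticFunction.moebius k : ℝ) / (k:ℝ)^(d+1)| ≤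
      2 * C * (H:ℝ)^d := by
    rw [hP, Finset.mul_sum, ← Finset.sum_sub_distrib]
    calc _ ≤ ∑ k ∈ Finset.Icc 1 H, C * (H:ℝ)^d * (1 / (k:ℝ)^2) := by
          refine (Finset.abs_sum_le_sum_abs _ _).trans (Finset.sum_le_sum fun k hk => ?_)
          rw [Finset.mem_Icc] at hk
          have hk1 : (1:ℝ) ≤ k := by exact_mod_cast hk.1
          have hkH : (k:ℝ) ≤ H := by exact_mod_cast hk.2
          have hk0 : (0:ℝ) < k := by linarith
          have := lattice_count I hI d (H/k) ((H:ℝ)/k) Nat.cast_div_le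
            (by
              rw [div_lt_iff₀ hk0]
              have := Nat.lt_mul_div_succ H (by omega : 0 < k)
              have h' : (H:ℝ) < k * ((H/k : ℕ) + 1) := by exact_mod_cast this
              linarith)
            (by rw [le_div_iff₀ hk0]; linarith)
          have e : (ArithmeticFunction.moebius k : ℝ) * (Lsum I d (H / k) : ℝ) -
              (H:ℝ) ^ (d+1) * Arho I d * ((ArithmeticFunction.moebius k : ℝ) / (k:ℝ)^(d+1)) =
              (ArithmeticFunction.moebius k : ℝ) * ((Lsum I d (H / k) : ℝ) - ((H:ℝ)/k)^(d+1) * Arho I d) := by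
            rw [div_pow]; ring
          rw [e, abs_mul]
          calc _ ≤ 1 * (C * ((H:ℝ)/k)^d) := by
                gcongr
                · exact hmu k
            _ = C * (H:ℝ)^d * (1 / (k:ℝ)^d) := by rw [div_pow]; ring
            _ ≤ _ := by gcongr
      _ ≤ C * (H:ℝ)^d * 2 := by
          rw [← Finset.mul_sum]
          gcongr
          exact sum_inv_sq_Icc H
      _ = _ := by ring
  have h2 : |(H:ℝ) ^ (d+1) * Arho I d * ∑ k ∈ Finset.Icc 1 H, (ArithmeticFunction.moebius k : ℝ) / (k:ℝ)^(d+1) -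
      (H:ℝ) ^ (d+1) * Arho I d / zetaR (d+1)| ≤ d * 2^(d+1) * (H:ℝ)^d := by
    have := moebius_tail (d+1) (by omega) H hH
    rw [div_eq_mul_one_div _ (zetaR (d+1)), ← mul_sub, abs_mul, abs_of_nonneg (by positivity)]
    calc _ ≤ (H:ℝ)^(d+1) * Arho I d * (1 / H) := by gcongr
      _ = Arho I d * (H:ℝ)^d := by rw [pow_succ]; field_simp
      _ ≤ _ := by gcongr
  calc _ ≤ _ := abs_sub_le _ _ _
    _ ≤ _ := add_le_add h1 h2
    _ = _ := by ring

end

section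


/-- integer polynomial with given coefficient vector -/
def ip {N : ℕ} (a : Fin N → ℤ) : Polynomial ℤ := ∑ i : Fin N, Polynomial.monomial (i:ℕ) (a i)

lemma ip_coeff {N : ℕ} (a : Fin N → ℤ) (k : ℕ) : (ip a).coeff k = if h : k < N then a ⟨k, h⟩ else 0 := by
  classical
  unfold ip
  rw [Polynomial.finsetSum_coeff]
  simp only [Polynomial.coeff_monomial]
  split_ifs with h
  · rw [Finset.sum_eq_single ⟨k, h⟩]
    · simp
    · intro b _ hb
      rw [if_neg]
      intro h'; exact hb (Fin.ext h')
    · simp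
  · apply Finset.sum_eq_zero
    intro b _
    rw [if_neg]
    intro h'; have := b.2; omega

lemma ip_of_poly (P : Polynomial ℤ) (N : ℕ) (h : P.natDegree < N) : ip (fun i : Fin N => P.coeff i) = P := by
  ext k
  rw [ip_coeff]
  split_ifs with hk
  · rfl
  · rw [Polynomial.coeff_eq_zero_of_natDegree_lt (by omega)]

lemma ip_natDegree {d : ℕ} (a : Fin (d+1) → ℤ) : (ip a).natDegree ≤ d := by
  rw [Polynomial.natDegree_le_iff_coeff_eq_zero]
  intro k hk
  rw [ip_coeff, dif_neg (by omega)]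

lemma ip_map {N : ℕ} (a : Fin N → ℤ) : (ip a).map (Int.castRingHom ℝ) = rp (fun i => (a i : ℝ)) := by
  unfold ip rp
  rw [Polynomial.map_sum]
  simp

lemma mahler_bound (Q R : Polynomial ℤ) (d H : ℕ) (hd : (Q * R).natDegree ≤ d) (h0 : Q * R ≠ 0)
    (hH : ∀ k, |(Q * R).coeff k| ≤ H) (i j : ℕ) :
    (Q.coeff i).natAbs * (R.coeff j).natAbs ≤ 2 ^ d * (d+1) * H := by
  have hinj : Function.Injective (Int.castRingHom ℂ) := Int.cast_injective
  set q := Q.map (Int.castRingHom ℂ) with hq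
  set r := R.map (Int.castRingHom ℂ) with hr
  have hQ0 : Q ≠ 0 := left_ne_zero_of_mul h0
  have hR0 : R ≠ 0 := right_ne_zero_of_mul h0
  have dq : q.natDegree = Q.natDegree := Polynomial.natDegree_map_eq_of_injective hinj Q
  have dr : r.natDegree = R.natDegree := Polynomial.natDegree_map_eq_of_injective hinj R
  have dsum : Q.natDegree + R.natDegree ≤ d := by rw [← Polynomial.natDegree_mul hQ0 hR0]; exact hd
  have b1 := Polynomial.norm_coeff_le_choose_mul_mahlerMeasure i q
  have b2 := Polynomial.norm_coeff_le_choose_mul_mahlerMeasure j r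
  have ch : ∀ n k : ℕ, ((n.choose k : ℕ) : ℝ) ≤ 2 ^ n := fun n k => by exact_mod_cast Nat.choose_le_two_pow n k
  have m3 : (q * r).mahlerMeasure ≤ (d+1) * H := by
    refine (Polynomial.mahlerMeasure_le_sum_norm_coeff (q*r)).trans ?_
    rw [Polynomial.sum_over_range _ (by simp)]
    have hdeg : (q*r).natDegree ≤ d := by
      rw [hq, hr, ← Polynomial.map_mul]; exact (Polynomial.natDegree_map_le).trans hd
    calc _ ≤ ∑ k ∈ Finset.range ((q*r).natDegree + 1), (H:ℝ) := by
          refine Finset.sum_le_sum fun k _ => ?_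
          rw [hq, hr, ← Polynomial.map_mul, Polynomial.coeff_map]
          have := hH k
          simp only [eq_intCast, Complex.norm_intCast]
          exact_mod_cast this
      _ = ((q*r).natDegree + 1) * H := by simp
      _ ≤ _ := by gcongr
  rw [Polynomial.mahlerMeasure_mul] at m3
  have nq := q.mahlerMeasure_nonneg
  have nr := r.mahlerMeasure_nonneg
  have e1 : ‖q.coeff i‖ = ((Q.coeff i).natAbs : ℝ) := by
    rw [hq, Polynomial.coeff_map]; simp [Complex.norm_intCast, Nat.cast_natAbs]
  have e2 : ‖r.coeff j‖ = ((R.coeff j).natAbs : ℝ) := by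
    rw [hr, Polynomial.coeff_map]; simp [Complex.norm_intCast, Nat.cast_natAbs]
  rw [e1, dq] at b1
  rw [e2, dr] at b2
  have : ((Q.coeff i).natAbs : ℝ) * ((R.coeff j).natAbs : ℝ) ≤ 2 ^ d * (d+1) * H := by
    calc _ ≤ (2 ^ Q.natDegree * q.mahlerMeasure) * (2 ^ R.natDegree * r.mahlerMeasure) := by
          refine mul_le_mul (b1.trans ?_) (b2.trans ?_) (by positivity) (by positivity)
          · exact mul_le_mul_of_nonneg_right (ch _ _) nq
          · exact mul_le_mul_of_nonneg_right (ch _ _) nr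
      _ = 2 ^ (Q.natDegree + R.natDegree) * (q.mahlerMeasure * r.mahlerMeasure) := by rw [pow_add]; ring
      _ ≤ 2 ^ d * ((d+1) * H) := by
          gcongr
          norm_num
      _ = _ := by ring
  exact_mod_cast this

lemma card_ibox (d h : ℕ) : (ibox d h).card = (2*h+1)^(d+1) := by
  rw [ibox, Fintype.card_piFinset_const]
  congr 1
  rw [Int.card_Icc]; omega

/-- vectors of height exactly `h` -/
def sph (k h : ℕ) : Finset (Fin (k+1) → ℤ) := (ibox k h).filter (fun a => ∃ i, (a i).natAbs = h)

lemma card_sph (k h : ℕ) : (sph k h).card ≤ 2 * (k+1) * (2*h+1)^k := by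
  classical
  have hsub : sph k h ⊆ Finset.univ.biUnion (fun i : Fin (k+1) =>
      Fintype.piFinset (Function.update (fun _ : Fin (k+1) => Finset.Icc (-(h:ℤ)) h) i {(h:ℤ), -(h:ℤ)})) := by
    intro a ha
    rw [sph, Finset.mem_filter] at ha
    obtain ⟨hb, i, hi⟩ := ha
    rw [Finset.mem_biUnion]
    refine ⟨i, Finset.mem_univ _, ?_⟩
    rw [Fintype.mem_piFinset]
    intro j
    by_cases hj : j = i
    · subst hj
      rw [Function.update_self]
      simp only [Finset.mem_insert, Finset.mem_singleton]
      omega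
    · rw [Function.update_of_ne hj]
      have := (mem_ibox k h a).1 hb j
      rw [abs_le] at this
      exact Finset.mem_Icc.2 this
  refine (Finset.card_le_card hsub).trans (Finset.card_biUnion_le.trans ?_)
  have : ∀ i ∈ (Finset.univ : Finset (Fin (k+1))), (Fintype.piFinset (Function.update (fun _ : Fin (k+1) => Finset.Icc (-(h:ℤ)) h) i {(h:ℤ), -(h:ℤ)})).card ≤ 2 * (2*h+1)^k := by
    intro i _
    rw [Fintype.card_piFinset, ← Finset.mul_prod_erase _ _ (Finset.mem_univ i), Function.update_self]
    apply Nat.mul_le_mul Finset.card_le_two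
    rw [Finset.prod_congr rfl (g := fun _ => 2*h+1)]
    · rw [Finset.prod_const, Finset.card_erase_of_mem (Finset.mem_univ i)]; simp
    · intro j hj
      rw [Function.update_of_ne (Finset.ne_of_mem_erase hj), Int.card_Icc]; omega
  refine (Finset.sum_le_card_nsmul _ _ _ this).trans ?_
  simp only [Finset.card_univ, Fintype.card_fin, smul_eq_mul]
  apply le_of_eq; ring

open Classical in
/-- coefficient vectors of reducible polynomials of exact degree `d` -/
def Red (d H : ℕ) : Finset (Fin (d+1) → ℤ) :=
  (ibox d H).filter (fun a => ∃ Q R : Polynomial ℤ, ip a = Q * R ∧ (ip a).natDegree = d ∧ 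
    1 ≤ Q.natDegree ∧ 1 ≤ R.natDegree)

def mulv (d k l : ℕ) (x : (Fin (k+1) → ℤ) × (Fin (l+1) → ℤ)) : Fin (d+1) → ℤ :=
  fun i => (ip x.1 * ip x.2).coeff i

lemma red_sub (d H : ℕ) (hd : 1 ≤ d) : Red d H ⊆
    (Finset.Icc 1 (d/2)).biUnion fun k => (Finset.Icc 1 (2^d*(d+1)*H)).biUnion fun h =>
      ((sph k h) ×ˢ (ibox (d-k) (2^d*(d+1)*H / h))).image (mulv d k (d-k)) := by
  classical
  intro a ha
  rw [Red, Finset.mem_filter] at ha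
  obtain ⟨hbox, Q, R, hQR, hdeg, h1, h2⟩ := ha
  wlog hle : Q.natDegree ≤ R.natDegree generalizing Q R
  · exact this R Q (by rw [hQR, mul_comm]) h2 h1 (by omega)
  have h0 : Q * R ≠ 0 := by
    intro h
    rw [hQR, h] at hdeg; simp at hdeg; omega
  have hQ0 : Q ≠ 0 := left_ne_zero_of_mul h0
  have hR0 : R ≠ 0 := right_ne_zero_of_mul h0
  have hsum : Q.natDegree + R.natDegree = d := by
    rw [← Polynomial.natDegree_mul hQ0 hR0, ← hQR, hdeg]
  have hcoef : ∀ k, |(Q*R).coeff k| ≤ H := by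
    intro k
    rw [← hQR, ip_coeff]
    split_ifs with hk
    · exact (mem_ibox d H a).1 hbox _
    · simp
  have hmb := mahler_bound Q R d H (by rw [← hQR, hdeg]) h0 hcoef
  set k := Q.natDegree with hk
  set q : Fin (k+1) → ℤ := fun i => Q.coeff i with hq
  set r : Fin (d-k+1) → ℤ := fun i => R.coeff i with hr
  obtain ⟨i0, -, hi0⟩ := Finset.exists_max_image (Finset.univ : Finset (Fin (k+1))) (fun i => (q i).natAbs) ⟨0, Finset.mem_univ _⟩
  set h := (q i0).natAbs with hh
  have hhpos : 1 ≤ h := by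
    have := hi0 ⟨k, by omega⟩ (Finset.mem_univ _)
    have h3 : q ⟨k, by omega⟩ ≠ 0 := by
      change Q.coeff Q.natDegree ≠ 0
      exact Polynomial.leadingCoeff_ne_zero.2 hQ0
    have := Int.natAbs_pos.2 h3
    omega
  rw [Finset.mem_biUnion]
  refine ⟨k, Finset.mem_Icc.2 ⟨h1, by omega⟩, ?_⟩
  rw [Finset.mem_biUnion]
  refine ⟨h, Finset.mem_Icc.2 ⟨hhpos, ?_⟩, ?_⟩
  · have h3 := hmb i0 R.natDegree
    have h4 : 1 ≤ (R.coeff R.natDegree).natAbs := Int.natAbs_pos.2 (Polynomial.leadingCoeff_ne_zero.2 hR0)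
    calc h ≤ h * (R.coeff R.natDegree).natAbs := Nat.le_mul_of_pos_right _ h4
      _ ≤ _ := h3
  · rw [Finset.mem_image]
    refine ⟨(q, r), ?_, ?_⟩
    · rw [Finset.mem_product]
      constructor
      · rw [sph, Finset.mem_filter, mem_ibox]
        refine ⟨fun i => ?_, i0, rfl⟩
        have := hi0 i (Finset.mem_univ _)
        change (q i).natAbs ≤ h at this
        change |q i| ≤ _
        rw [abs_le]; omega
      · rw [mem_ibox]
        intro j
        have h3 : h * (r j).natAbs ≤ _ := hmb i0 j
        have h4 : (r j).natAbs ≤ 2^d*(d+1)*H / h := by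
          rw [Nat.le_div_iff_mul_le hhpos]; linarith
        change |r j| ≤ _
        rw [Int.abs_eq_natAbs]
        exact_mod_cast h4
    · funext i
      change (ip q * ip r).coeff i = a i
      rw [hq, hr, ip_of_poly Q _ (by omega), ip_of_poly R _ (by omega), ← hQR, ip_coeff, dif_pos i.2]

lemma term_bound (d k h X : ℕ) (hk : 1 ≤ k) (hkd : 2 * k ≤ d) (hh : 1 ≤ h) (hX : h ≤ X) :
    (((sph k h).card * (ibox (d-k) (X/h)).card : ℕ) : ℝ) ≤
      2 * (d+1) * 3^(d+1) * ((X:ℝ)^k * ((X:ℝ)/h)^(d+1-2*k)) := by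
  have hh' : (1:ℝ) ≤ h := by exact_mod_cast hh
  have hXr : (1:ℝ) ≤ (X:ℝ)/h := by rw [le_div_iff₀ (by positivity)]; simpa using (by exact_mod_cast hX : (h:ℝ) ≤ X)
  have c1 : ((sph k h).card : ℝ) ≤ 2 * (d+1) * (3*h)^k := by
    have := card_sph k h
    have h2 : ((sph k h).card : ℝ) ≤ 2 * (k+1) * (2*h+1)^k := by exact_mod_cast this
    have hkd' : (k:ℝ) ≤ d := by exact_mod_cast (by omega : k ≤ d)
    refine h2.trans ?_
    gcongr
    linarith
  have c2 : ((ibox (d-k) (X/h)).card : ℝ) ≤ (3*((X:ℝ)/h))^(d-k+1) := by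
    rw [card_ibox]
    push_cast
    have : ((X/h : ℕ):ℝ) ≤ (X:ℝ)/h := Nat.cast_div_le
    gcongr
    linarith
  push_cast
  calc _ ≤ (2 * (d+1) * (3*(h:ℝ))^k) * (3*((X:ℝ)/h))^(d-k+1) := by gcongr
    _ = 2 * (d+1) * (3^k * 3^(d-k+1)) * (((h:ℝ)^k * ((X:ℝ)/h)^k) * ((X:ℝ)/h)^(d+1-2*k)) := by
        rw [mul_pow, mul_pow, show d-k+1 = k + (d+1-2*k) by omega, pow_add ((X:ℝ)/h)]; ring
    _ = _ := by
        rw [← pow_add, ← mul_pow, mul_div_cancel₀ _ (by positivity : (h:ℝ) ≠ 0), show k + (d-k+1) = d+1 by omega]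

lemma sum_h_bound (d k X : ℕ) (hd : 2 ≤ d) (hk : 1 ≤ k) (hkd : 2 * k ≤ d) (hX : 1 ≤ X) :
    ∑ h ∈ Finset.Icc 1 X, ((X:ℝ)^k * ((X:ℝ)/h)^(d+1-2*k)) ≤ 2 * (X:ℝ)^d * (1 + Real.log X)^(lfun d) := by
  have hX' : (1:ℝ) ≤ X := by exact_mod_cast hX
  have hlog : 0 ≤ Real.log X := Real.log_nonneg hX'
  have hL : 1 ≤ (1 + Real.log X)^(lfun d) := one_le_pow₀ (by linarith)
  rcases Nat.lt_or_ge (2*k) d with hlt | hge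
  · calc _ ≤ ∑ h ∈ Finset.Icc 1 X, (X:ℝ)^d * (1 / (h:ℝ)^2) := by
          refine Finset.sum_le_sum fun h hh => ?_
          have hh' : (1:ℝ) ≤ h := by exact_mod_cast (Finset.mem_Icc.1 hh).1
          rw [div_pow, mul_div_assoc', ← pow_add, mul_one_div]
          gcongr
          · omega
          · omega
      _ ≤ (X:ℝ)^d * 2 := by
          rw [← Finset.mul_sum]; gcongr; exact sum_inv_sq_Icc X
      _ = 2 * (X:ℝ)^d * 1 := by ring
      _ ≤ _ := by gcongr
  · have e : d = 2 * k := by omega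
    have hs : ∑ h ∈ Finset.Icc 1 X, ((X:ℝ)^k * ((X:ℝ)/h)^(d+1-2*k)) ≤ (X:ℝ)^(k+1) * (1 + Real.log X) := by
      have h1 := harmonic_le_one_add_log X
      rw [harmonic_eq_sum_Icc] at h1
      push_cast at h1
      calc _ = (X:ℝ)^(k+1) * ∑ h ∈ Finset.Icc 1 X, (h:ℝ)⁻¹ := by
            rw [Finset.mul_sum]
            refine Finset.sum_congr rfl fun h _ => ?_
            rw [show d+1-2*k = 1 by omega, pow_one, pow_succ, div_eq_mul_inv]; ring
        _ ≤ _ := by gcongr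
    refine hs.trans ?_
    by_cases hk1 : k = 1
    · subst hk1
      subst e
      have : lfun (2*1) = 1 := by simp [lfun]
      rw [this]
      norm_num
      have : 0 ≤ (X:ℝ)^2 * (1 + Real.log X) := by positivity
      linarith
    · have : lfun d = 0 := by rw [lfun, if_neg]; omega
      rw [this, pow_zero, mul_one]
      have h3 : 1 + Real.log X ≤ X := by
        have := Real.log_le_sub_one_of_pos (by linarith : (0:ℝ) < X); linarith
      calc _ ≤ (X:ℝ)^(k+1) * X := by gcongr
        _ = (X:ℝ)^(k+2) := by ring
        _ ≤ (X:ℝ)^d := pow_le_pow_right₀ hX' (by omega)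
        _ ≤ _ := by have : 0 ≤ (X:ℝ)^d := by positivity
                    linarith

lemma red_count (d H : ℕ) (hd : 2 ≤ d) (hH : 2 ≤ H) :
    ((Red d H).card : ℝ) ≤ 28 * d * (d+1) * 3^(d+1) * (2^d*(d+1))^d * (H:ℝ)^d * Real.log H ^ lfun d := by
  classical
  set X := 2^d*(d+1)*H with hXdef
  have hX : 1 ≤ X := by
    have : 0 < 2^d*(d+1)*H := by positivity
    omega
  have h1 : ((Red d H).card : ℝ) ≤ ∑ k ∈ Finset.Icc 1 (d/2), ∑ h ∈ Finset.Icc 1 X,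
      (((sph k h).card * (ibox (d-k) (X/h)).card : ℕ) : ℝ) := by
    have := (Finset.card_le_card (red_sub d H (by omega))).trans
      (Finset.card_biUnion_le.trans (Finset.sum_le_sum fun k _ => Finset.card_biUnion_le.trans
        (Finset.sum_le_sum fun h _ => Finset.card_image_le.trans (Finset.card_product _ _).le)))
    exact_mod_cast this
  have hlog2 : (1:ℝ)/2 ≤ Real.log 2 := by have := Real.log_two_gt_d9; linarith
  have hHr : (2:ℝ) ≤ H := by exact_mod_cast hH
  have hlogH : Real.log 2 ≤ Real.log H := Real.log_le_log (by norm_num) hHr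
  have hLX : (1 + Real.log X)^(lfun d) ≤ 7 * Real.log H ^ lfun d := by
    by_cases h2 : d = 2
    · have : lfun d = 1 := by simp [lfun, h2]
      rw [this, pow_one, pow_one, hXdef, h2]
      push_cast
      rw [Real.log_mul (by norm_num) (by positivity)]
      have h16 : Real.log 12 ≤ 4 * Real.log 2 := by
        rw [← Real.log_rpow (by norm_num)]
        apply Real.log_le_log <;> norm_num
      norm_num
      linarith
    · have : lfun d = 0 := by simp [lfun, h2]
      rw [this]; norm_num
  have hd' : ((d/2 : ℕ):ℝ) ≤ d := by exact_mod_cast Nat.div_le_self d 2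
  calc _ ≤ _ := h1
    _ ≤ ∑ k ∈ Finset.Icc 1 (d/2), 2 * (d+1) * 3^(d+1) * (2 * (X:ℝ)^d * (1 + Real.log X)^(lfun d)) := by
        refine Finset.sum_le_sum fun k hk => ?_
        rw [Finset.mem_Icc] at hk
        refine le_trans (Finset.sum_le_sum (g := fun h : ℕ => 2 * (d+1) * 3^(d+1) * ((X:ℝ)^k * ((X:ℝ)/h)^(d+1-2*k))) fun h hh => ?_) ?_
        · rw [Finset.mem_Icc] at hh
          exact term_bound d k h X hk.1 (by omega) hh.1 hh.2
        · rw [← Finset.mul_sum]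
          gcongr
          exact sum_h_bound d k X hd hk.1 (by omega) hX
    _ = (d/2 : ℕ) * (2 * (d+1) * 3^(d+1) * (2 * (X:ℝ)^d * (1 + Real.log X)^(lfun d))) := by
        rw [Finset.sum_const]; simp
    _ ≤ d * (2 * (d+1) * 3^(d+1) * (2 * (X:ℝ)^d * (7 * Real.log H ^ lfun d))) := by
        have : 0 ≤ Real.log X := Real.log_nonneg (by exact_mod_cast hX)
        gcongr
    _ = _ := by
        rw [hXdef]; push_cast; rw [mul_pow _ (H:ℝ)]; ring

end

section


open Classical in
def Irr (d H : ℕ) : Finset (Fin (d+1) → ℤ) :=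
  (ibox d H).filter (fun a => Irreducible (ip a) ∧ (ip a).natDegree = d)

lemma ip_primitive {N : ℕ} (a : Fin N → ℤ) : (ip a).IsPrimitive ↔ Finset.univ.gcd a = 1 := by
  have hC : ∀ r : ℤ, Polynomial.C r ∣ ip a ↔ r ∣ Finset.univ.gcd a := by
    intro r
    rw [Polynomial.C_dvd_iff_dvd_coeff, Finset.dvd_gcd_iff]
    constructor
    · intro h i _
      have := h i
      rwa [ip_coeff, dif_pos i.2] at this
    · intro h k
      rw [ip_coeff]
      split_ifs with hk
      · exact h _ (Finset.mem_univ _)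
      · exact dvd_zero _
  constructor
  · intro h
    have h1 := h _ ((hC _).2 dvd_rfl)
    rw [← normalize_eq_one] at h1
    rwa [Finset.normalize_gcd] at h1
  · intro h r hr
    rw [hC, h] at hr
    exact isUnit_of_dvd_one hr

lemma ip_inj {N : ℕ} (a b : Fin N → ℤ) (h : ip a = ip b) : a = b := by
  funext i
  have := congrArg (fun P => Polynomial.coeff P i) h
  simpa [ip_coeff] using this

lemma ip_neg {N : ℕ} (a : Fin N → ℤ) : ip (-a) = - ip a := by
  ext k
  rw [Polynomial.coeff_neg, ip_coeff, ip_coeff]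
  split_ifs <;> simp

lemma irr_unique (P Q : Polynomial ℤ) (hP : Irreducible P) (hQ : Irreducible Q) (hPd : P.natDegree ≠ 0)
    (hQd : Q.natDegree ≠ 0) (α : ℝ) (h1 : Polynomial.aeval α P = 0) (h2 : Polynomial.aeval α Q = 0) :
    P = Q ∨ P = -Q := by
  have pP := hP.isPrimitive hPd
  have pQ := hQ.isPrimitive hQd
  have iP := (Polynomial.IsPrimitive.Int.irreducible_iff_irreducible_map_cast pP).1 hP
  have iQ := (Polynomial.IsPrimitive.Int.irreducible_iff_irreducible_map_cast pQ).1 hQ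
  have hmap : ∀ R : Polynomial ℤ, Polynomial.aeval α (R.map (Int.castRingHom ℚ)) = Polynomial.aeval α R := by
    intro R
    exact Polynomial.aeval_map_algebraMap ℚ α R
  have ass : ∀ R : Polynomial ℤ, Irreducible (R.map (Int.castRingHom ℚ)) → Polynomial.aeval α R = 0 →
      Associated (minpoly ℚ α) (R.map (Int.castRingHom ℚ)) := by
    intro R iR hR
    have hdv := minpoly.dvd ℚ α (by rw [hmap]; exact hR : Polynomial.aeval α (R.map (Int.castRingHom ℚ)) = 0)
    exact (minpoly.not_isUnit ℚ α |> fun hu => (iR.dvd_iff.1 hdv).resolve_left hu).symm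
  have a1 := (ass P iP h1).symm.trans (ass Q iQ h2)
  have d1 := (Polynomial.IsPrimitive.Int.dvd_iff_map_cast_dvd_map_cast P Q pP).2 a1.dvd
  have d2 := (Polynomial.IsPrimitive.Int.dvd_iff_map_cast_dvd_map_cast Q P pQ).2 a1.symm.dvd
  obtain ⟨u, hu⟩ := (associated_of_dvd_dvd d1 d2).symm
  obtain ⟨c, hc, hcu⟩ := Polynomial.isUnit_iff.1 u.isUnit
  rw [← hcu] at hu
  rcases Int.isUnit_iff.1 hc with rfl | rfl
  · left; rw [← hu]; simp
  · right; rw [← hu]; simp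

lemma rp_ip_eval {N : ℕ} (a : Fin N → ℤ) (α : ℝ) : (rp (fun i => (a i : ℝ))).eval α = Polynomial.aeval α (ip a) := by
  rw [← ip_map, Polynomial.eval_map, Polynomial.aeval_def]; rfl

/-- the finite set of algebraic numbers of degree `d` and height at most `H` -/
def Afin (d H : ℕ) : Finset ℝ := (Irr d H).biUnion fun a => (rp (fun i => (a i : ℝ))).roots.toFinset

lemma irr_ne {d H : ℕ} {a : Fin (d+1) → ℤ} (ha : a ∈ Irr d H) : rp (fun i => (a i : ℝ)) ≠ 0 := by
  classical
  rw [Irr, Finset.mem_filter] at ha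
  rw [← ip_map]
  intro h
  exact ha.2.1.ne_zero ((Polynomial.map_eq_zero_iff Int.cast_injective).1 h)

lemma mem_Afin (d H : ℕ) (α : ℝ) : α ∈ Afin d H ↔ IsAlgDegHt α d H := by
  classical
  unfold Afin
  rw [Finset.mem_biUnion]
  constructor
  · rintro ⟨a, ha, hα⟩
    have hne := irr_ne ha
    rw [Multiset.mem_toFinset, Polynomial.mem_roots hne, Polynomial.IsRoot, rp_ip_eval] at hα
    rw [Irr, Finset.mem_filter, mem_ibox] at ha
    refine ⟨ip a, ha.2.1, ha.2.2, fun k => ?_, hα⟩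
    rw [ip_coeff]
    split_ifs with hk
    · have := ha.1 ⟨k, hk⟩
      exact_mod_cast this
    · simp
  · rintro ⟨P, hP, hdeg, hH, hα⟩
    have hip : ip (fun i : Fin (d+1) => P.coeff i) = P := ip_of_poly P (d+1) (by omega)
    have hmem : (fun i : Fin (d+1) => P.coeff i) ∈ Irr d H := by
      rw [Irr, Finset.mem_filter, mem_ibox, hip]
      refine ⟨fun i => ?_, hP, hdeg⟩
      have := hH i
      exact_mod_cast this
    refine ⟨_, hmem, ?_⟩
    rw [Multiset.mem_toFinset, Polynomial.mem_roots (irr_ne hmem), Polynomial.IsRoot, rp_ip_eval, hip]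
    exact hα

open Classical in
lemma irr_sum (I : Set ℝ) (d H : ℕ) (hd : 1 ≤ d) :
    ∑ a ∈ Irr d H, NI I (fun i => (a i : ℝ)) = 2 * ((Afin d H).filter (· ∈ I)).card := by
  have h1 : ∀ a ∈ Irr d H, NI I (fun i => (a i : ℝ)) =
      ∑ α ∈ (Afin d H).filter (· ∈ I), if Polynomial.aeval α (ip a) = 0 then 1 else 0 := by
    intro a ha
    rw [← Finset.card_filter]
    unfold NI
    congr 1
    ext α
    simp only [Finset.mem_filter]
    have hr : α ∈ (rp (fun i => (a i : ℝ))).roots.toFinset ↔ Polynomial.aeval α (ip a) = 0 := by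
      rw [Multiset.mem_toFinset, Polynomial.mem_roots (irr_ne ha), Polynomial.IsRoot, rp_ip_eval]
    constructor
    · rintro ⟨h, hI⟩
      exact ⟨⟨Finset.mem_biUnion.2 ⟨a, ha, h⟩, hI⟩, hr.1 h⟩
    · rintro ⟨⟨_, hI⟩, h⟩
      exact ⟨hr.2 h, hI⟩
  rw [Finset.sum_congr rfl h1, Finset.sum_comm]
  have h2 : ∀ α ∈ (Afin d H).filter (· ∈ I), ∑ a ∈ Irr d H, (if Polynomial.aeval α (ip a) = 0 then 1 else 0) = 2 := by
    intro α hα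
    rw [← Finset.card_filter]
    rw [Finset.mem_filter] at hα
    obtain ⟨a, ha, hr⟩ := Finset.mem_biUnion.1 hα.1
    rw [Multiset.mem_toFinset, Polynomial.mem_roots (irr_ne ha), Polynomial.IsRoot, rp_ip_eval] at hr
    have ha' := ha
    rw [Irr, Finset.mem_filter, mem_ibox] at ha'
    have hne : a ≠ -a := by
      intro h
      have h0 : a = 0 := by
        funext i
        have := congrFun h i
        simp only [Pi.neg_apply] at this
        simp only [Pi.zero_apply]; omega
      apply ha'.2.1.ne_zero
      rw [h0]; simp [ip]
    rw [Finset.card_eq_two]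
    refine ⟨a, -a, hne, ?_⟩
    ext b
    simp only [Finset.mem_filter, Finset.mem_insert, Finset.mem_singleton]
    constructor
    · rintro ⟨hb, hbr⟩
      rw [Irr, Finset.mem_filter] at hb
      rcases irr_unique (ip b) (ip a) hb.2.1 ha'.2.1 (by omega) (by omega) α hbr hr with h | h
      · left; exact ip_inj _ _ h
      · right; apply ip_inj; rw [h, ip_neg]
    · rintro (rfl | rfl)
      · exact ⟨ha, hr⟩
      · refine ⟨?_, by rw [ip_neg]; simpa using hr⟩
        rw [Irr, Finset.mem_filter, mem_ibox, ip_neg]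
        refine ⟨fun i => by simpa using ha'.1 i, (Associated.refl (ip a)).neg_right.irreducible ha'.2.1, by simpa using ha'.2.2⟩
  rw [Finset.sum_congr rfl h2]
  simp [mul_comm]

lemma prim_irr (I : Set ℝ) (d H : ℕ) (hd : 1 ≤ d) :
    ∑ a ∈ Irr d H, NI I (fun i => (a i : ℝ)) ≤ Prim I d H ∧
    Prim I d H ≤ ∑ a ∈ Irr d H, NI I (fun i => (a i : ℝ)) + d * ((2*H+1)^d + (Red d H).card) := by
  classical
  have hsub : Irr d H ⊆ (ibox d H).filter (fun a => Finset.univ.gcd a = 1) := by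
    intro a ha
    rw [Irr, Finset.mem_filter] at ha
    rw [Finset.mem_filter]
    exact ⟨ha.1, (ip_primitive a).1 (ha.2.1.isPrimitive (by omega))⟩
  refine ⟨Finset.sum_le_sum_of_subset hsub, ?_⟩
  set Z0 := Fintype.piFinset (Function.update (fun _ : Fin (d+1) => Finset.Icc (-(H:ℤ)) H) (Fin.last d) {0}) with hZ0
  have hZc : Z0.card = (2*H+1)^d := by
    rw [hZ0, Fintype.card_piFinset, ← Finset.mul_prod_erase _ _ (Finset.mem_univ (Fin.last d)), Function.update_self,
      Finset.card_singleton, one_mul]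
    rw [Finset.prod_congr rfl (g := fun _ => 2*H+1)]
    · rw [Finset.prod_const, Finset.card_erase_of_mem (Finset.mem_univ _)]; simp
    · intro j hj
      rw [Function.update_of_ne (Finset.ne_of_mem_erase hj), Int.card_Icc]; omega
  have hcov : (ibox d H).filter (fun a => Finset.univ.gcd a = 1) ⊆ Irr d H ∪ (Z0 ∪ Red d H) := by
    intro a ha
    rw [Finset.mem_filter] at ha
    obtain ⟨hb, hg⟩ := ha
    rw [Finset.mem_union, Finset.mem_union]
    by_cases h0 : a (Fin.last d) = 0
    · right; left
      rw [hZ0, Fintype.mem_piFinset]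
      intro j
      by_cases hj : j = Fin.last d
      · subst hj; rw [Function.update_self]; simpa using h0
      · rw [Function.update_of_ne hj]
        have := (mem_ibox d H a).1 hb j
        rw [abs_le] at this
        exact Finset.mem_Icc.2 this
    · have hdeg : (ip a).natDegree = d := by
        apply le_antisymm (ip_natDegree a)
        apply Polynomial.le_natDegree_of_ne_zero
        rw [ip_coeff, dif_pos (by omega)]
        exact h0
      by_cases hirr : Irreducible (ip a)
      · left
        rw [Irr, Finset.mem_filter]; exact ⟨hb, hirr, hdeg⟩
      · right; right
        have hprim := (ip_primitive a).2 hg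
        have hnu : ¬ IsUnit (ip a) := by
          intro hu
          have := Polynomial.natDegree_eq_zero_of_isUnit hu
          omega
        rw [irreducible_iff] at hirr
        push Not at hirr
        obtain ⟨Q, R, hQR, hQ, hR⟩ := hirr hnu
        have key : ∀ S : Polynomial ℤ, S ∣ ip a → ¬ IsUnit S → 1 ≤ S.natDegree := by
          intro S hS hSu
          by_contra hlt
          have h0 : S.natDegree = 0 := by omega
          rw [Polynomial.eq_C_of_natDegree_eq_zero h0] at hS hSu
          exact hSu (Polynomial.isUnit_C.2 (hprim _ hS))
        rw [Red, Finset.mem_filter]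
        exact ⟨hb, Q, R, hQR, hdeg, key Q ⟨R, hQR⟩ hQ, key R ⟨Q, by rw [hQR, mul_comm]⟩ hR⟩
  unfold Prim
  calc _ ≤ ∑ a ∈ Irr d H ∪ (Z0 ∪ Red d H), NI I (fun i => (a i : ℝ)) := Finset.sum_le_sum_of_subset hcov
    _ ≤ ∑ a ∈ Irr d H, NI I (fun i => (a i : ℝ)) + ∑ a ∈ Z0 ∪ Red d H, NI I (fun i => (a i : ℝ)) := by
        rw [← Finset.sum_union_inter]; exact Nat.le_add_right _ _
    _ ≤ _ := by
        gcongr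
        refine (Finset.sum_le_card_nsmul _ _ d (fun a _ => NI_le _ _)).trans ?_
        rw [smul_eq_mul, mul_comm]
        gcongr
        rw [← hZc]
        exact Finset.card_union_le _ _

/-- the one-dimensional error constant -/
def Cd (d : ℕ) : ℝ := 100 * (d+1)^3 * 3^(d+1) * (2^d*(d+1))^d

open Classical in
lemma koleda (I : Set ℝ) (hI : I.OrdConnected) (d H : ℕ) (hd : 2 ≤ d) (hH : 2 ≤ H) :
    |(((Afin d H).filter (· ∈ I)).card : ℝ) / (H:ℝ)^(d+1) - Arho I d / (2 * zetaR (d+1))| ≤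
      Cd d * (Real.log H ^ lfun d / H) := by
  have h1 := prim_count I hI d H hd (by omega)
  obtain ⟨h2, h3⟩ := prim_irr I d H (by omega)
  rw [irr_sum I d H (by omega)] at h2 h3
  have h4 := red_count d H hd hH
  set N := ((Afin d H).filter (· ∈ I)).card
  have h2' : 2 * (N:ℝ) ≤ Prim I d H := by exact_mod_cast h2
  have h3' : (Prim I d H : ℝ) ≤ 2 * N + d * ((2*H+1)^d + (Red d H).card) := by exact_mod_cast h3
  have hHr : (2:ℝ) ≤ H := by exact_mod_cast hH
  have hdr : (2:ℝ) ≤ d := by exact_mod_cast hd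
  have hz := zetaR_ge (d+1) (by omega)
  set L := Real.log H ^ lfun d with hLdef
  have hL : 1/2 ≤ L := by
    have hlog2 : (1:ℝ)/2 ≤ Real.log 2 := by have := Real.log_two_gt_d9; linarith
    have hlogH : Real.log 2 ≤ Real.log H := Real.log_le_log (by norm_num) hHr
    rw [hLdef, lfun]
    split_ifs
    · rw [pow_one]; linarith
    · norm_num
  have h5 : ((2*(H:ℝ)+1)^d) ≤ 3^d * (H:ℝ)^d := by
    rw [← mul_pow]; gcongr; linarith
  have hHd : (0:ℝ) < (H:ℝ)^d := by positivity
  set W : ℝ := (2^d*(d+1))^d with hW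
  have hW1 : 1 ≤ W := one_le_pow₀ (by
    have : (1:ℝ) ≤ 2^d := one_le_pow₀ (by norm_num)
    nlinarith)
  have h3d : (2:ℝ)^(d+1) ≤ 3^(d+1) := by gcongr; norm_num
  have h3e : (3:ℝ)^(d+1) = 3 * 3^d := by rw [pow_succ]; ring
  set T : ℝ := 3^d with hT
  have hT0 : 0 < T := by positivity
  have main : |2 * (N:ℝ) - (H:ℝ)^(d+1) * Arho I d / zetaR (d+1)| ≤ 2 * (Cd d * L * (H:ℝ)^d) := by
    have e1 : |2 * (N:ℝ) - Prim I d H| ≤ d * (T * (H:ℝ)^d + 28 * d * (d+1) * 3^(d+1) * W * (H:ℝ)^d * L) := by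
      have : d * ((2*(H:ℝ)+1)^d + (Red d H).card) ≤ d * (T * (H:ℝ)^d + 28 * d * (d+1) * 3^(d+1) * W * (H:ℝ)^d * L) := by
        gcongr
      rw [abs_le]; constructor <;> linarith
    have e2 := (abs_sub_le (2*(N:ℝ)) (Prim I d H) ((H:ℝ)^(d+1) * Arho I d / zetaR (d+1))).trans (add_le_add e1 h1)
    refine e2.trans ?_
    have hWL : 1 ≤ 2 * (W * L) := by nlinarith
    have b1 : d * T ≤ d * T * (2 * (W*L)) := le_mul_of_one_le_right (by positivity) hWL
    have b2 : (2 * ((2 * d + 3) * (d + 1) * T) + d * (2:ℝ)^(d+1)) ≤ (2 * ((2 * d + 3) * (d + 1) * T) + d * (3 * T)) * (2 * (W * L)) := by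
      refine le_trans ?_ (le_mul_of_one_le_right (by positivity) hWL)
      rw [← h3e]; gcongr
    have key : d * (T + 28 * d * (d+1) * (3*T) * W * L) + (2 * ((2 * d + 3) * (d + 1) * T) + d * (2:ℝ)^(d+1)) ≤
        2 * (100 * (d+1)^3 * (3*T) * W * L) := by
      have hQ : 0 ≤ T * W * L := by positivity
      have hp : 2 * d + 84 * (d:ℝ)^2 * (d+1) + 4 * (2*d+3)*(d+1) + 6*d ≤ 600 * (d+1)^3 := by
        nlinarith [sq_nonneg (d:ℝ), mul_nonneg (sq_nonneg (d:ℝ)) (by linarith : (0:ℝ) ≤ d)]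
      have := mul_le_mul_of_nonneg_right hp hQ
      nlinarith
    have k2 := mul_le_mul_of_nonneg_right key hHd.le
    rw [Cd, ← hW, h3e]
    calc _ = (d * (T + 28 * d * (d+1) * (3*T) * W * L) + (2 * ((2 * d + 3) * (d + 1) * T) + d * (2:ℝ)^(d+1))) * (H:ℝ)^d := by
          ring
      _ ≤ _ := k2
      _ = _ := by ring
  have hH0 : (0:ℝ) < (H:ℝ)^(d+1) := by positivity
  have e : (N:ℝ) / (H:ℝ)^(d+1) - Arho I d / (2 * zetaR (d+1)) =
      (2 * (N:ℝ) - (H:ℝ)^(d+1) * Arho I d / zetaR (d+1)) / (2 * (H:ℝ)^(d+1)) := by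
    have : zetaR (d+1) ≠ 0 := by linarith
    field_simp
  rw [e, abs_div, abs_of_pos (by positivity : (0:ℝ) < 2 * (H:ℝ)^(d+1)), div_le_iff₀ (by positivity)]
  refine main.trans (le_of_eq ?_)
  rw [pow_succ]; field_simp

end

section


def muD (d H : ℕ) : Measure ℝ := ENNReal.ofReal (1 / (H:ℝ)^(d+1)) • ∑ α ∈ Afin d H, Measure.dirac α

def dens (d : ℕ) (x : ℝ) : ℝ := rho d x / (2 * zetaR (d+1))

def nuD (d : ℕ) : Measure ℝ := volume.withDensity fun x => ENNReal.ofReal (dens d x)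

lemma zpos (d : ℕ) (hd : 2 ≤ d) : 0 < 2 * zetaR (d+1) := by
  have := zetaR_ge (d+1) (by omega); linarith

lemma dens_nonneg (d : ℕ) (hd : 2 ≤ d) (x : ℝ) : 0 ≤ dens d x :=
  div_nonneg (rho_nonneg d x) (zpos d hd).le

lemma dens_meas (d : ℕ) : Measurable (dens d) := (rho_measurable d).div_const _

open Classical in
lemma muD_apply (d H : ℕ) (J : Set ℝ) (hJ : MeasurableSet J) :
    muD d H J = ENNReal.ofReal ((((Afin d H).filter (· ∈ J)).card : ℝ) / (H:ℝ)^(d+1)) := by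
  rw [muD, Measure.smul_apply, Measure.finsetSum_apply]
  simp_rw [Measure.dirac_apply' _ hJ]
  rw [smul_eq_mul, div_eq_mul_one_div (Nat.cast _ : ℝ), mul_comm, ENNReal.ofReal_mul (Nat.cast_nonneg _), ENNReal.ofReal_natCast,
    Finset.card_filter, Nat.cast_sum]
  congr 1
  refine Finset.sum_congr rfl fun a _ => ?_
  by_cases ha : a ∈ J <;> simp [ha]

lemma nuD_apply (d : ℕ) (hd : 2 ≤ d) (J : Set ℝ) (hJ : J.OrdConnected) :
    nuD d J = ENNReal.ofReal (Arho J d / (2 * zetaR (d+1))) := by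
  rw [nuD, withDensity_apply _ hJ.measurableSet]
  unfold dens
  simp_rw [div_eq_mul_inv _ (2 * zetaR (d+1)), ENNReal.ofReal_mul (rho_nonneg d _)]
  rw [lintegral_mul_const _ (rho_meas d), ← Arho_ofReal J hJ, ENNReal.ofReal_mul (Arho_nonneg J d)]

lemma disc1 (d H : ℕ) (hd : 2 ≤ d) (hH : 2 ≤ H) (J : Set ℝ) (hJ : J.OrdConnected) :
    muD d H J ≤ nuD d J + ENNReal.ofReal (Cd d * (Real.log H ^ lfun d / H)) ∧
    nuD d J ≤ muD d H J + ENNReal.ofReal (Cd d * (Real.log H ^ lfun d / H)) := by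
  classical
  rw [muD_apply d H J hJ.measurableSet, nuD_apply d hd J hJ]
  have h := koleda J hJ d H hd hH
  have h0 := (abs_nonneg _).trans h
  rw [abs_le] at h
  have hA : 0 ≤ Arho J d / (2 * zetaR (d+1)) := div_nonneg (Arho_nonneg J d) (zpos d hd).le
  rw [← ENNReal.ofReal_add hA h0, ← ENNReal.ofReal_add (by positivity) h0]
  constructor <;> apply ENNReal.ofReal_le_ofReal <;> linarith

def Md (d : ℕ) : ℝ := d * 3^(d+1)

lemma muD_univ (d H : ℕ) (hH : 1 ≤ H) : muD d H univ ≤ ENNReal.ofReal (Md d) := by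
  classical
  rw [muD_apply d H univ MeasurableSet.univ]
  simp only [mem_univ, Finset.filter_true]
  apply ENNReal.ofReal_le_ofReal
  have hHr : (1:ℝ) ≤ H := by exact_mod_cast hH
  rw [div_le_iff₀ (by positivity)]
  have h1 : (Afin d H).card ≤ (2*H+1)^(d+1) * d := by
    unfold Afin
    refine Finset.card_biUnion_le.trans ((Finset.sum_le_card_nsmul _ _ d fun a ha => ?_).trans ?_)
    · refine (Multiset.toFinset_card_le _).trans ((Polynomial.card_roots' _).trans ?_)
      rw [← ip_map]
      exact Polynomial.natDegree_map_le.trans (ip_natDegree a)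
    · rw [smul_eq_mul]
      gcongr
      rw [← card_ibox]
      unfold Irr
      exact Finset.card_filter_le _ _
  have h2 : ((Afin d H).card : ℝ) ≤ (2*H+1)^(d+1) * d := by exact_mod_cast h1
  refine h2.trans ?_
  rw [Md, mul_comm, mul_assoc, ← mul_pow]
  gcongr
  linarith

lemma nuD_univ (d : ℕ) (hd : 2 ≤ d) : nuD d univ ≤ ENNReal.ofReal (Md d) := by
  rw [nuD_apply d hd univ ordConnected_univ]
  apply ENNReal.ofReal_le_ofReal
  have h1 := Arho_le univ ordConnected_univ d
  have h2 : 1 ≤ 2 * zetaR (d+1) := by have := zetaR_ge (d+1) (by omega); linarith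
  refine (div_le_self (Arho_nonneg _ _) h2).trans (h1.trans ?_)
  rw [Md]; gcongr; norm_num

lemma Md_ge (d : ℕ) (hd : 2 ≤ d) : 1 ≤ Md d := by
  have : (2:ℝ) ≤ d := by exact_mod_cast hd
  have h3 : (1:ℝ) ≤ 3^(d+1) := one_le_pow₀ (by norm_num)
  rw [Md]; nlinarith

lemma dens_integrable (d : ℕ) (hd : 2 ≤ d) : Integrable (dens d) := by
  refine ⟨(dens_meas d).aestronglyMeasurable, ?_⟩
  rw [hasFiniteIntegral_iff_ofReal (Filter.Eventually.of_forall (dens_nonneg d hd))]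
  have := nuD_univ d hd
  rw [nuD, withDensity_apply _ MeasurableSet.univ, Measure.restrict_univ] at this
  exact this.trans_lt ENNReal.ofReal_lt_top

lemma pi_nuD {ι : Type} [Fintype ι] (d : ι → ℕ) (hd : ∀ i, 2 ≤ d i) :
    Measure.pi (fun i => nuD (d i)) =
      (volume : Measure (ι → ℝ)).withDensity (fun x => ENNReal.ofReal (∏ i, dens (d i) (x i))) := by
  have hfin : ∀ i, IsFiniteMeasure (nuD (d i)) := fun i => ⟨(nuD_univ _ (hd i)).trans_lt ENNReal.ofReal_lt_top⟩
  apply Measure.pi_eq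
  intro s hs
  rw [withDensity_apply _ (MeasurableSet.univ_pi hs), ← lintegral_indicator (MeasurableSet.univ_pi hs)]
  set g : ι → ℝ → ℝ := fun i => (s i).indicator (dens (d i)) with hg
  have hg0 : ∀ i x, 0 ≤ g i x := fun i x => indicator_nonneg (fun _ _ => dens_nonneg _ (hd i) _) x
  have hgi : ∀ i, Integrable (g i) := fun i => (dens_integrable _ (hd i)).indicator (hs i)
  have e1 : ∀ x : ι → ℝ, (univ.pi s).indicator (fun x => ENNReal.ofReal (∏ i, dens (d i) (x i))) x =
      ENNReal.ofReal (∏ i, g i (x i)) := by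
    intro x
    by_cases hx : x ∈ univ.pi s
    · rw [indicator_of_mem hx]
      congr 1
      refine Finset.prod_congr rfl fun i _ => ?_
      rw [hg]; simp only
      rw [indicator_of_mem (hx i (mem_univ i))]
    · rw [indicator_of_notMem hx]
      rw [mem_univ_pi] at hx
      push Not at hx
      obtain ⟨i, hi⟩ := hx
      rw [Finset.prod_eq_zero (Finset.mem_univ i)]
      · simp
      · rw [hg]; simp only
        rw [indicator_of_notMem hi]
  simp_rw [e1]
  have h_int : Integrable (fun x : ι → ℝ => ∏ i, g i (x i)) := Integrable.fintype_prod hgi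
  rw [← ofReal_integral_eq_lintegral_ofReal h_int (Filter.Eventually.of_forall fun x =>
    Finset.prod_nonneg fun i _ => hg0 i _), integral_fintype_prod_volume_eq_prod,
    ENNReal.ofReal_prod_of_nonneg (fun i _ => integral_nonneg (hg0 i))]
  refine Finset.prod_congr rfl fun i _ => ?_
  rw [nuD, withDensity_apply _ (hs i), ofReal_integral_eq_lintegral_ofReal (hgi i) (Filter.Eventually.of_forall (hg0 i)),
    ← lintegral_indicator (hs i)]
  refine lintegral_congr fun x => ?_
  rw [hg]; simp only
  by_cases hx : x ∈ s i <;> simp [hx]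

/-- properties of a fibre of a semialgebraic family -/
lemma fibre_props (m n : ℕ) (Ω : Set (Fin m → ℝ)) (Z : (Fin m → ℝ) → Set (Fin n × Fin n → ℝ)) (s p : ℕ)
    (hrep : HasSemialgRep
      {z : (Fin m ⊕ Fin n × Fin n) → ℝ |
        (fun i => z (Sum.inl i)) ∈ Ω ∧
        (fun v => z (Sum.inr v)) ∈ Z (fun i => z (Sum.inl i))} s p)
    (t : Fin m → ℝ) (ht : t ∈ Ω) :
    MeasurableSet (Z t) ∧ ∀ x v, IsIntv (2 * (s * p) + 1)
      (fun a => (Z t).indicator (fun _ => (1:ENNReal)) (Function.update x v a)) := by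
  obtain ⟨P, c, sel, hdeg, hS⟩ := hrep
  have hmem : ∀ x : Fin n × Fin n → ℝ, x ∈ Z t ↔ ∃ j, ∀ i, (sel j i).elim True
      (fun e => if e then MvPolynomial.eval (Sum.elim t x) (P i) = 0
                else 0 < MvPolynomial.eval (Sum.elim t x) (P i)) := by
    intro x
    have := Set.ext_iff.1 hS (Sum.elim t x)
    rw [mem_iUnion] at this
    simp only [mem_ofPred_eq, Sum.elim_inl, Sum.elim_inr] at this
    rw [← this]
    exact ⟨fun h => ⟨ht, h⟩, fun h => h.2⟩
  constructor
  · have hZ : Z t = ⋃ j, ⋂ i, {x | (sel j i).elim True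
      (fun e => if e then MvPolynomial.eval (Sum.elim t x) (P i) = 0
                else 0 < MvPolynomial.eval (Sum.elim t x) (P i))} := by
      ext x
      rw [hmem]; simp only [mem_iUnion, mem_iInter, mem_ofPred_eq]
    rw [hZ]
    refine MeasurableSet.iUnion fun j => MeasurableSet.iInter fun i => ?_
    have hcont : Continuous fun x : Fin n × Fin n → ℝ => MvPolynomial.eval (Sum.elim t x) (P i) := by
      refine (MvPolynomial.continuous_eval (P i)).comp ?_
      refine continuous_pi fun w => ?_
      rcases w with w | w
      · exact continuous_const
      · exact continuous_apply w
    rcases sel j i with _ | (_ | _)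
    · simp
    · simpa using (isOpen_lt continuous_const hcont).measurableSet
    · simpa using (isClosed_eq hcont continuous_const).measurableSet
  · intro x v
    let F : (Fin m ⊕ Fin n × Fin n) → Polynomial ℝ :=
      Sum.elim (fun i => Polynomial.C (t i)) (Function.update (fun w => Polynomial.C (x w)) v Polynomial.X)
    let q : Fin s → Polynomial ℝ := fun i => MvPolynomial.aeval F (P i)
    have F1 : ∀ i, F (Sum.inl i) = Polynomial.C (t i) := fun _ => rfl
    have F2 : F (Sum.inr v) = Polynomial.X := by
      change Function.update (fun w => Polynomial.C (x w)) v Polynomial.X v = _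
      rw [Function.update_self]
    have F3 : ∀ w, w ≠ v → F (Sum.inr w) = Polynomial.C (x w) := by
      intro w h
      change Function.update (fun w => Polynomial.C (x w)) v Polynomial.X w = _
      rw [Function.update_of_ne h]
    have hF : ∀ w, (F w).natDegree ≤ 1 := by
      intro w
      rcases w with w | w
      · rw [F1, Polynomial.natDegree_C]; omega
      · by_cases h : w = v
        · rw [h, F2]; exact Polynomial.natDegree_X_le
        · rw [F3 w h, Polynomial.natDegree_C]; omega
    have hq : ∀ i, (q i).natDegree ≤ p := by
      intro i
      have := MvPolynomial.aeval_natDegree_le (P i) (hdeg i) F hF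
      simpa using this
    have hev : ∀ i a, (q i).eval a = MvPolynomial.eval (Sum.elim t (Function.update x v a)) (P i) := by
      intro i a
      have h1 : (q i).eval a = MvPolynomial.aeval (fun w => (F w).eval a) (P i) := by
        have := MvPolynomial.comp_aeval_apply F (Polynomial.aeval a) (P i)
        simpa only [Polynomial.coe_aeval_eq_eval] using this
      rw [h1, MvPolynomial.aeval_eq_eval]
      congr 2
      funext w
      rcases w with w | w
      · rw [F1, Polynomial.eval_C]; rfl
      · by_cases h : w = v
        · rw [h, F2, Polynomial.eval_X, Sum.elim_inr, Function.update_self]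
        · rw [F3 w h, Polynomial.eval_C, Sum.elim_inr, Function.update_of_ne h]
    have := isIntv_semialg s p c q hq sel
    convert this using 1
    funext a
    have hiff : Function.update x v a ∈ Z t ↔ a ∈ {a : ℝ | ∃ j, ∀ i, (sel j i).elim True
      (fun e => if e then (q i).eval a = 0 else 0 < (q i).eval a)} := by
      rw [hmem]; simp only [mem_ofPred_eq, hev]
    by_cases h : Function.update x v a ∈ Z t
    · rw [indicator_of_mem h, indicator_of_mem (hiff.1 h)]
    · rw [indicator_of_notMem h, indicator_of_notMem (fun h' => h (hiff.2 h'))]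

end


lemma Cd_le (d D S : ℕ) (h : d + 1 ≤ D) (hS : D + 3 ≤ S) : Cd d ≤ 2 ^ (2 * S^2) := by
  have h1 : ((d:ℝ)+1) ≤ 2^d := by
    have : d + 1 ≤ 2^d := Nat.lt_two_pow_self
    exact_mod_cast this
  have h3 : (3:ℝ)^(d+1) ≤ 2^(2*(d+1)) := by
    rw [pow_mul]; gcongr; norm_num
  calc Cd d ≤ 2^7 * (2^d)^3 * 2^(2*(d+1)) * (2^d * 2^d)^d := by
        unfold Cd
        gcongr
        norm_num
    _ = 2 ^ (7 + d*3 + 2*(d+1) + (d+d)*d) := by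
        simp only [← pow_add, ← pow_mul]
    _ ≤ _ := by
        apply pow_le_pow_right₀ (by norm_num)
        have : d + 4 ≤ S := by omega
        nlinarith

lemma const_bound (n : ℕ) (hn : 1 ≤ n) (d : Fin n → ℕ) (hd : ∀ i, 2 ≤ d i) (s p : ℕ) :
    (∀ i, Cd (d i) ≤ 2 ^ (2 * (Sconst n d s)^2)) ∧
    ((2 * (s * p) + 1 : ℕ) : ℝ) * ((n * n : ℕ) : ℝ) * 2 ^ (2 * (Sconst n d s)^2) * (∏ v : Fin n × Fin n, Md (d v.2)) ≤
      M1const n d s p := by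
  set S := Sconst n d s with hSdef
  set D := Dconst n d with hDdef
  set q := pZd n d s p with hqdef
  have i0 : Fin n := ⟨0, by omega⟩
  have hprod : 1 ≤ ∏ i, d i := Finset.one_le_prod' fun i _ => by have := hd i; omega
  have hprod2 : 2 ≤ ∏ i, d i :=
    (hd i0).trans (Finset.single_le_prod' (f := d) (fun i _ => by have := hd i; omega) (Finset.mem_univ i0))
  have hpn : 2 ≤ (∏ i, d i)^n := hprod2.trans (Nat.le_self_pow (by omega) _)
  have hdD : ∀ i, d i + 1 ≤ D := fun i =>
    Finset.single_le_sum (f := fun i => d i + 1) (fun _ _ => Nat.zero_le _) (Finset.mem_univ i)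
  have hD3 : 3 ≤ D := by have := hdD i0; have := hd i0; omega
  have hSeq : S = s + n * (D + (∏ i, d i)^n + 1) := rfl
  have hDS : D + 3 ≤ S := by
    rw [hSeq]
    have : 1 * (D + (∏ i, d i)^n + 1) ≤ n * (D + (∏ i, d i)^n + 1) := Nat.mul_le_mul_right _ hn
    omega
  have hsS : s ≤ S := by rw [hSeq]; omega
  have hnS : n ≤ S := by
    rw [hSeq]
    have : n * 1 ≤ n * (D + (∏ i, d i)^n + 1) := Nat.mul_le_mul_left _ (by omega)
    omega
  refine ⟨fun i => Cd_le (d i) D S (hdD i) hDS, ?_⟩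
  have hP2 : 2 ≤ Pconst n d p := (hd i0).trans ((Finset.le_sup (f := d) (Finset.mem_univ i0)).trans (le_max_right _ _))
  have hpP : p ≤ Pconst n d p := le_max_left _ _
  have hPq : Pconst n d p ≤ q := by
    rw [hqdef, pZd]
    calc Pconst n d p ≤ Pconst n d p ^ (4 ^ (Dconst n d + n)) := Nat.le_self_pow (by positivity) _
      _ ≤ _ := Nat.le_mul_of_pos_left _ (by positivity)
  have hsZ : 3 * S^2 ≤ sZd n d s p := by
    rw [sZd]
    calc 3 * S^2 ≤ 3 * S ^ (2 ^ (Dconst n d + n)) := by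
          gcongr
          · omega
          · exact Nat.le_self_pow (by omega) 2
      _ ≤ _ := Nat.le_mul_of_pos_right _ (by
          have : 0 < Pconst n d p := by omega
          positivity)
  have hqr : (2:ℝ) ≤ q := by exact_mod_cast hP2.trans hPq
  have hS6 : 6 ≤ S := by omega
  -- the power estimate
  have hpow : (3 * (S:ℝ)^3) * 2 ^ (2 * S^2) ≤ (2 * (q:ℝ) - 1) ^ (n + sZd n d s p - 1) := by
    have hS2 : (S:ℝ) ≤ 2^S := by exact_mod_cast Nat.lt_two_pow_self.le
    calc (3 * (S:ℝ)^3) * 2 ^ (2 * S^2) ≤ (2^2 * (2^S)^3) * 2 ^ (2 * S^2) := by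
          gcongr; norm_num
      _ = 2 ^ (2 + S * 3 + 2 * S^2) := by simp only [← pow_add, ← pow_mul]
      _ ≤ 2 ^ (3 * S^2) := by
          apply pow_le_pow_right₀ (by norm_num)
          nlinarith
      _ ≤ 2 ^ (n + sZd n d s p - 1) := pow_le_pow_right₀ (by norm_num) (by omega)
      _ ≤ _ := by gcongr; linarith
  have hlin : ((2 * (s * p) + 1 : ℕ) : ℝ) * ((n * n : ℕ) : ℝ) ≤ (q:ℝ) * (3 * (S:ℝ)^3) := by
    have h1 : 2 * (s * p) + 1 ≤ 3 * (S * q) := by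
      have a : s * p ≤ S * q := Nat.mul_le_mul hsS (hpP.trans hPq)
      have b : 1 ≤ S * q := Nat.mul_pos (by omega) (by omega)
      omega
    have h2 : n * n ≤ S * S := Nat.mul_le_mul hnS hnS
    have h3 := Nat.mul_le_mul h1 h2
    have h4 : (((2 * (s * p) + 1) * (n * n) : ℕ) : ℝ) ≤ ((3 * (S * q) * (S * S) : ℕ) : ℝ) := by exact_mod_cast h3
    push_cast at h4 ⊢
    calc _ ≤ _ := h4
      _ = _ := by ring
  have hM : (∏ v : Fin n × Fin n, Md (d v.2)) ≤ ((∏ i, d i : ℕ) : ℝ)^n * 2 ^ (n * (2 * D + 1) + 1) := by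
    rw [Fintype.prod_prod_type]
    simp only [Finset.prod_const, Finset.card_univ, Fintype.card_fin]
    unfold Md
    rw [Finset.prod_mul_distrib, Finset.prod_pow_eq_pow_sum, mul_pow]
    push_cast
    gcongr
    change ((3:ℝ)^D)^n ≤ _
    calc ((3:ℝ)^D)^n ≤ ((2^2)^D)^n := by gcongr; norm_num
      _ = 2 ^ (2 * D * n) := by simp only [← pow_mul]
      _ ≤ _ := by
          apply pow_le_pow_right₀ (by norm_num)
          nlinarith
  have hMn : 0 ≤ (∏ v : Fin n × Fin n, Md (d v.2)) := Finset.prod_nonneg fun v _ => by unfold Md; positivity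
  have hE : 0 ≤ sSup (Set.range fun i : Fin n => E1 (d i)) := by
    apply Real.sSup_nonneg
    rintro _ ⟨i, rfl⟩
    unfold E1; positivity
  have hq1 : 0 ≤ 2 * (q:ℝ) - 1 := by linarith
  unfold M1const
  calc _ ≤ ((q:ℝ) * (3 * (S:ℝ)^3)) * 2 ^ (2 * S^2) * (((∏ i, d i : ℕ) : ℝ)^n * 2 ^ (n * (2 * D + 1) + 1)) := by
        gcongr
    _ = ((q:ℝ) * ((3 * (S:ℝ)^3) * 2 ^ (2 * S^2))) * (((∏ i, d i : ℕ) : ℝ)^n * 2 ^ (n * (2 * D + 1) + 1)) := by ring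
    _ ≤ ((q:ℝ) * (2 * (q:ℝ) - 1) ^ (n + sZd n d s p - 1)) * (((∏ i, d i : ℕ) : ℝ)^n * 2 ^ (n * (2 * D + 1) + 1)) := by
        gcongr
    _ = ((∏ i, d i : ℕ) : ℝ) ^ n * (0 + 2 ^ (n * (2 * D + 1) + 1) * (q:ℝ) * (2 * (q:ℝ) - 1) ^ (n + sZd n d s p - 1)) := by
        ring
    _ ≤ _ := by
        gcongr
        positivity

theorem stmt17 (m n : ℕ) (hm : 1 ≤ m) (hn : 1 ≤ n)
    (d : Fin n → ℕ) (hd : ∀ i, 2 ≤ d i)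
    (Ω : Set (Fin m → ℝ)) (Z : (Fin m → ℝ) → Set (Fin n × Fin n → ℝ))
    (hbdd : ∀ t, Bornology.IsBounded (Z t))
    (s p : ℕ)
    (hrep : HasSemialgRep
      {z : (Fin m ⊕ Fin n × Fin n) → ℝ |
        (fun i => z (Sum.inl i)) ∈ Ω ∧
        (fun v => z (Sum.inr v)) ∈ Z (fun i => z (Sum.inl i))} s p)
    (t : Fin m → ℝ) (ht : t ∈ Ω) (Hv : Fin n → ℕ) (hHv : ∀ i, 2 ≤ Hv i) :
    |(Set.ncard {x : Fin n × Fin n → ℝ |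
          x ∈ Z t ∧ ∀ k i : Fin n, IsAlgDegHt (x (k, i)) (d i) (Hv i)} : ℝ) /
          (∏ i, (Hv i : ℝ) ^ (d i + 1)) ^ n -
        ∫ x in Z t, ∏ k : Fin n, ∏ i : Fin n,
          rho (d i) (x (k, i)) / (2 * zetaR (d i + 1))| ≤
      M1const n d s p *
        sSup (Set.range fun i : Fin n => Real.log (Hv i) ^ lfun (d i) / (Hv i : ℝ)) := by
  classical
  obtain ⟨hZm, hslice⟩ := fibre_props m n Ω Z s p hrep t ht
  obtain ⟨hCd, hconst⟩ := const_bound n hn d hd s p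
  set C : ℝ := 2 ^ (2 * (Sconst n d s)^2) with hC
  have hC0 : 0 ≤ C := by positivity
  set σ : ℝ := sSup (Set.range fun i : Fin n => Real.log (Hv i) ^ lfun (d i) / (Hv i : ℝ)) with hσ
  have hterm0 : ∀ i, 0 ≤ Real.log (Hv i) ^ lfun (d i) / (Hv i : ℝ) := fun i => by
    have : 0 ≤ Real.log (Hv i) := Real.log_natCast_nonneg _
    positivity
  have hσle : ∀ i, Real.log (Hv i) ^ lfun (d i) / (Hv i : ℝ) ≤ σ := fun i =>
    le_csSup (Set.finite_range _).bddAbove ⟨i, rfl⟩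
  have hσ0 : 0 ≤ σ := (hterm0 ⟨0, by omega⟩).trans (hσle _)
  set μ : Fin n × Fin n → Measure ℝ := fun v => muD (d v.2) (Hv v.2) with hμ
  set ν : Fin n × Fin n → Measure ℝ := fun v => nuD (d v.2) with hν
  set M : Fin n × Fin n → ENNReal := fun v => ENNReal.ofReal (Md (d v.2)) with hM
  set δ : ENNReal := ENNReal.ofReal (C * σ) with hδ
  have hμM : ∀ v, μ v univ ≤ M v := fun v => muD_univ _ _ (by have := hHv v.2; omega)
  have hνM : ∀ v, ν v univ ≤ M v := fun v => nuD_univ _ (hd v.2)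
  have hμf : ∀ v, IsFiniteMeasure (μ v) := fun v => ⟨(hμM v).trans_lt ENNReal.ofReal_lt_top⟩
  have hνf : ∀ v, IsFiniteMeasure (ν v) := fun v => ⟨(hνM v).trans_lt ENNReal.ofReal_lt_top⟩
  have hdel : ∀ v : Fin n × Fin n, ENNReal.ofReal (Cd (d v.2) * (Real.log (Hv v.2) ^ lfun (d v.2) / (Hv v.2 : ℝ))) ≤ δ * M v := by
    intro v
    rw [hδ, hM]
    simp only
    rw [← ENNReal.ofReal_mul (by positivity)]
    apply ENNReal.ofReal_le_ofReal
    calc _ ≤ C * σ := mul_le_mul (hCd v.2) (hσle v.2) (hterm0 _) hC0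
      _ ≤ _ := le_mul_of_one_le_right (by positivity) (Md_ge _ (hd v.2))
  set f : (Fin n × Fin n → ℝ) → ENNReal := (Z t).indicator (fun _ => 1) with hf
  have hfm : Measurable f := measurable_const.indicator hZm
  have k1 := hybrid (2 * (s * p) + 1) δ μ ν hμf hνf M hμM hνM
    (fun v J hJ => (disc1 _ _ (hd v.2) (hHv v.2) J hJ).1.trans (add_le_add le_rfl (hdel v))) f hfm hslice
  have k2 := hybrid (2 * (s * p) + 1) δ ν μ hνf hμf M hνM hμM
    (fun v J hJ => (disc1 _ _ (hd v.2) (hHv v.2) J hJ).2.trans (add_le_add le_rfl (hdel v))) f hfm hslice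
  -- error term
  set E : ℝ := ((2 * (s * p) + 1 : ℕ) : ℝ) * ((n * n : ℕ) : ℝ) * (C * σ) * ∏ v : Fin n × Fin n, Md (d v.2) with hE
  have hMd0 : ∀ e, 0 ≤ Md e := fun e => by unfold Md; positivity
  have hprod0 : 0 ≤ ∏ v : Fin n × Fin n, Md (d v.2) := Finset.prod_nonneg fun v _ => hMd0 _
  have hE0 : 0 ≤ E := by positivity
  have hEe : ((2 * (s * p) + 1 : ℕ) : ENNReal) * (Fintype.card (Fin n × Fin n) : ENNReal) * δ * ∏ v, M v = ENNReal.ofReal E := by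
    rw [hE, ENNReal.ofReal_mul (by positivity), ENNReal.ofReal_mul (by positivity), ENNReal.ofReal_mul (by positivity),
      ENNReal.ofReal_prod_of_nonneg (fun v _ => hMd0 _), ENNReal.ofReal_natCast, ENNReal.ofReal_natCast,
      Fintype.card_prod, Fintype.card_fin]
  have hEM : E ≤ M1const n d s p * σ := by
    calc E = ((2 * (s * p) + 1 : ℕ) : ℝ) * ((n * n : ℕ) : ℝ) * C * (∏ v : Fin n × Fin n, Md (d v.2)) * σ := by
          rw [hE]; ring
      _ ≤ _ := mul_le_mul_of_nonneg_right hconst hσ0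
  -- counting side
  set N := Set.ncard {x : Fin n × Fin n → ℝ |
          x ∈ Z t ∧ ∀ k i : Fin n, IsAlgDegHt (x (k, i)) (d i) (Hv i)} with hN
  have hNc : N = ((Fintype.piFinset fun v : Fin n × Fin n => Afin (d v.2) (Hv v.2)).filter (· ∈ Z t)).card := by
    rw [hN, ← Set.ncard_coe_finset]
    congr 1
    ext x
    simp only [mem_ofPred_eq, Finset.coe_filter, Fintype.mem_piFinset, mem_Afin, Prod.forall]
    tauto
  have c1 : ∫⁻ x, f x ∂(Measure.pi μ) = ENNReal.ofReal ((N:ℝ) / (∏ i, (Hv i : ℝ) ^ (d i + 1)) ^ n) := by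
    have hpi : Measure.pi μ = _ := pi_dirac (fun v : Fin n × Fin n => Afin (d v.2) (Hv v.2))
      (fun v => ENNReal.ofReal (1 / (Hv v.2:ℝ)^(d v.2+1))) (fun _ => ENNReal.ofReal_ne_top)
    rw [hpi, lintegral_smul_measure, lintegral_finsetSum_measure]
    simp_rw [lintegral_dirac' _ hfm]
    rw [← ENNReal.ofReal_prod_of_nonneg (fun v _ => by positivity), Fintype.prod_prod_type]
    simp only [Finset.prod_const, Finset.card_univ, Fintype.card_fin]
    rw [smul_eq_mul, div_eq_mul_one_div (N:ℝ), mul_comm, ENNReal.ofReal_mul (Nat.cast_nonneg _), ENNReal.ofReal_natCast]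
    congr 1
    · rw [hNc, Finset.card_filter, Nat.cast_sum]
      refine Finset.sum_congr rfl fun x _ => ?_
      by_cases hx : x ∈ Z t <;> simp [hf, hx]
    · congr 1
      simp only [one_div, Finset.prod_inv_distrib, inv_pow]
  have c2 : ∫⁻ x, f x ∂(Measure.pi ν) = ENNReal.ofReal (∫ x in Z t, ∏ k : Fin n, ∏ i : Fin n,
          rho (d i) (x (k, i)) / (2 * zetaR (d i + 1))) := by
    have hpi : Measure.pi ν = _ := pi_nuD (fun v : Fin n × Fin n => d v.2) (fun v => hd v.2)
    have hfinpi : (Measure.pi ν) (Z t) < ⊤ := measure_lt_top _ _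
    have e1 : ∫⁻ x, f x ∂(Measure.pi ν) = (Measure.pi ν) (Z t) := by
      rw [hf, lintegral_indicator hZm]; simp
    rw [e1]
    rw [hpi, withDensity_apply _ hZm] at hfinpi ⊢
    have hnn : ∀ x : Fin n × Fin n → ℝ, 0 ≤ ∏ v, dens (d v.2) (x v) := fun x =>
      Finset.prod_nonneg fun v _ => dens_nonneg _ (hd v.2) _
    have hmeas : Measurable fun x : Fin n × Fin n → ℝ => ∏ v, dens (d v.2) (x v) :=
      Finset.measurable_prod _ fun v _ => (dens_meas _).comp (measurable_pi_apply v)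
    have e2 : ∀ x : Fin n × Fin n → ℝ, ∏ k : Fin n, ∏ i : Fin n,
          rho (d i) (x (k, i)) / (2 * zetaR (d i + 1)) = ∏ v, dens (d v.2) (x v) := by
      intro x
      rw [Fintype.prod_prod_type]; rfl
    simp_rw [e2]
    rw [integral_eq_lintegral_of_nonneg_ae (Filter.Eventually.of_forall hnn) hmeas.aestronglyMeasurable,
      ENNReal.ofReal_toReal hfinpi.ne]
  have hI0 : 0 ≤ ∫ x in Z t, ∏ k : Fin n, ∏ i : Fin n,
          rho (d i) (x (k, i)) / (2 * zetaR (d i + 1)) :=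
    integral_nonneg fun x => Finset.prod_nonneg fun k _ => Finset.prod_nonneg fun i _ => dens_nonneg _ (hd i) _
  have hN0 : 0 ≤ (N:ℝ) / (∏ i, (Hv i : ℝ) ^ (d i + 1)) ^ n := by positivity
  rw [hEe, c1, c2] at k1 k2
  rw [← ENNReal.ofReal_add hI0 hE0, ENNReal.ofReal_le_ofReal_iff (by positivity)] at k1
  rw [← ENNReal.ofReal_add hN0 hE0, ENNReal.ofReal_le_ofReal_iff (by positivity)] at k2
  rw [abs_le]
  constructor <;> linarith
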